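/- arXiv:math/0208140 — 2 statements merged into one kernel-verified Lean document; each statement's English description precedes it below -/
import Mathlib

section
/- Let 𝒜 be the associative unital algebra with N² generators s_ij (1 ≤ i,j ≤ N) whose defining relations are encoded by the single reflection equation R S₁ Rᵗ S₂ = S₂ Rᵗ S₁ R for the matrix S = Σ_{i,j} s_ij ⊗ E_ij ∈ 𝒜 ⊗ End ℂᴺ. Then the ordered monomials s_11^{k_11} s_12^{k_12} ⋯ s_1N^{k_1N} ⋯ s_N1^{k_N1} s_N2^{k_N2} ⋯ s_NN^{k_NN}, with the factors arranged in lexicographic order of the index pairs (i,j) and with arbitrary nonnegative integer exponents k_ij, linearly span 𝒜. -/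
noncomputable section

open scoped TensorProduct

abbrev FF : Type := RatFunc ℂ

def qq : FF := RatFunc.X

/-! Constant R-matrices acting in `ℂ^N ⊗ ℂ^N`, written as matrices indexed by pairs. -/

def Rc (F : Type) [Field F] (q : F) (N : ℕ) :
    Matrix (Fin N × Fin N) (Fin N × Fin N) F := Matrix.of fun p r =>
  (if p = r then (if p.1 = p.2 then q else 1) else 0)
  + (if p.1 = r.2 ∧ p.2 = r.1 ∧ p.1 < p.2 then q - q⁻¹ else 0)

/-- `R` transposed in the first tensor factor. -/
def Rct (F : Type) [Field F] (q : F) (N : ℕ) :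
    Matrix (Fin N × Fin N) (Fin N × Fin N) F :=
  Matrix.of fun p r => Rc F q N (r.1, p.2) (p.1, r.2)

def Rtil (F : Type) [Field F] (q : F) (N : ℕ) :
    Matrix (Fin N × Fin N) (Fin N × Fin N) F := Matrix.of fun p r =>
  (if p = r then (if p.1 = p.2 then q⁻¹ else 1) else 0)
  + (if p.1 = r.2 ∧ p.2 = r.1 ∧ p.2 < p.1 then q⁻¹ - q else 0)

def Rtilt (F : Type) [Field F] (q : F) (N : ℕ) :
    Matrix (Fin N × Fin N) (Fin N × Fin N) F :=
  Matrix.of fun p r => Rtil F q N (r.1, p.2) (p.1, r.2)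

/-- `S ↦ S ⊗ 1` (action in the first copy of `End ℂ^N`). -/
def amp1 {A : Type} [Ring A] {N : ℕ} (M : Matrix (Fin N) (Fin N) A) :
    Matrix (Fin N × Fin N) (Fin N × Fin N) A :=
  Matrix.of fun p r => if p.2 = r.2 then M p.1 r.1 else 0

/-- `S ↦ 1 ⊗ S` (action in the second copy of `End ℂ^N`). -/
def amp2 {A : Type} [Ring A] {N : ℕ} (M : Matrix (Fin N) (Fin N) A) :
    Matrix (Fin N × Fin N) (Fin N × Fin N) A :=
  Matrix.of fun p r => if p.1 = r.1 then M p.2 r.2 else 0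

/-- A scalar matrix viewed as a matrix over an `F`-algebra `A`. -/
def liftF (F : Type) [Field F] {A : Type} [Ring A] [Algebra F A] {m : Type}
    (M : Matrix m m F) : Matrix m m A := M.map (algebraMap F A)

/-- Left hand side `R S₁ Rᵗ S₂` of the reflection equation. -/
def reflLHS (F : Type) [Field F] (q : F) {N : ℕ} {A : Type} [Ring A] [Algebra F A]
    (S : Matrix (Fin N) (Fin N) A) : Matrix (Fin N × Fin N) (Fin N × Fin N) A :=
  liftF F (Rc F q N) * amp1 S * liftF F (Rct F q N) * amp2 S

/-- Right hand side `S₂ Rᵗ S₁ R` of the reflection equation. -/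
def reflRHS (F : Type) [Field F] (q : F) {N : ℕ} {A : Type} [Ring A] [Algebra F A]
    (S : Matrix (Fin N) (Fin N) A) : Matrix (Fin N × Fin N) (Fin N × Fin N) A :=
  amp2 S * liftF F (Rct F q N) * amp1 S * liftF F (Rc F q N)

/-- The list of index pairs `(i,j)` in lexicographic order. -/
def lexPairs (N : ℕ) : List (Fin N × Fin N) :=
  (List.finRange N).flatMap fun i => (List.finRange N).map fun j => (i, j)

/-! The generic matrix of generators. -/

def Sfree (F : Type) [Field F] (N : ℕ) :
    Matrix (Fin N) (Fin N) (FreeAlgebra F (Fin N × Fin N)) :=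
  Matrix.of fun i j => FreeAlgebra.ι F (i, j)

/-- Defining relations: only the reflection equation. -/
inductive Rel0 (F : Type) [Field F] (q : F) (N : ℕ) :
    FreeAlgebra F (Fin N × Fin N) → FreeAlgebra F (Fin N × Fin N) → Prop
  | refl (p r : Fin N × Fin N) :
      Rel0 F q N (reflLHS F q (Sfree F N) p r) (reflRHS F q (Sfree F N) p r)

/-- The algebra with generators `s_ij` and the reflection equation as defining relations. -/
abbrev Alg0 (F : Type) [Field F] (q : F) (N : ℕ) := RingQuot (Rel0 F q N)

def s0 (F : Type) [Field F] (q : F) (N : ℕ) (i j : Fin N) : Alg0 F q N :=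
  RingQuot.mkAlgHom F (Rel0 F q N) (FreeAlgebra.ι F (i, j))

/-- Defining relations of the presented algebra `𝒮` of the orthogonal case. -/
inductive OSRel (F : Type) [Field F] (q : F) (N : ℕ) :
    FreeAlgebra F (Fin N × Fin N) → FreeAlgebra F (Fin N × Fin N) → Prop
  | tri (i j : Fin N) (h : i < j) : OSRel F q N (FreeAlgebra.ι F (i, j)) 0
  | diag (i : Fin N) : OSRel F q N (FreeAlgebra.ι F (i, i)) 1
  | refl (p r : Fin N × Fin N) :
      OSRel F q N (reflLHS F q (Sfree F N) p r) (reflRHS F q (Sfree F N) p r)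

abbrev AlgOS (F : Type) [Field F] (q : F) (N : ℕ) := RingQuot (OSRel F q N)

def sOS (F : Type) [Field F] (q : F) (N : ℕ) (i j : Fin N) : AlgOS F q N :=
  RingQuot.mkAlgHom F (OSRel F q N) (FreeAlgebra.ι F (i, j))

/-! The quantized enveloping algebra `U_q(gl_N)` by its RTT presentation. -/

abbrev GlGen (N : ℕ) := (Fin N × Fin N) ⊕ (Fin N × Fin N)

def Tfree (F : Type) [Field F] (N : ℕ) :
    Matrix (Fin N) (Fin N) (FreeAlgebra F (GlGen N)) :=
  Matrix.of fun i j => FreeAlgebra.ι F (Sum.inl (i, j))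

def Tbfree (F : Type) [Field F] (N : ℕ) :
    Matrix (Fin N) (Fin N) (FreeAlgebra F (GlGen N)) :=
  Matrix.of fun i j => FreeAlgebra.ι F (Sum.inr (i, j))

/-- `R X₁ Y₂` -/
def rttLHS (F : Type) [Field F] (q : F) {N : ℕ} {A : Type} [Ring A] [Algebra F A]
    (X Y : Matrix (Fin N) (Fin N) A) : Matrix (Fin N × Fin N) (Fin N × Fin N) A :=
  liftF F (Rc F q N) * amp1 X * amp2 Y

/-- `Y₂ X₁ R` -/
def rttRHS (F : Type) [Field F] (q : F) {N : ℕ} {A : Type} [Ring A] [Algebra F A]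
    (X Y : Matrix (Fin N) (Fin N) A) : Matrix (Fin N × Fin N) (Fin N × Fin N) A :=
  amp2 Y * amp1 X * liftF F (Rc F q N)

inductive GlRel (F : Type) [Field F] (q : F) (N : ℕ) :
    FreeAlgebra F (GlGen N) → FreeAlgebra F (GlGen N) → Prop
  | t_zero (i j : Fin N) (h : i < j) : GlRel F q N (Tfree F N i j) 0
  | tb_zero (i j : Fin N) (h : j < i) : GlRel F q N (Tbfree F N i j) 0
  | t_tb (i : Fin N) : GlRel F q N (Tfree F N i i * Tbfree F N i i) 1
  | tb_t (i : Fin N) : GlRel F q N (Tbfree F N i i * Tfree F N i i) 1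
  | rtt (p r : Fin N × Fin N) :
      GlRel F q N (rttLHS F q (Tfree F N) (Tfree F N) p r)
        (rttRHS F q (Tfree F N) (Tfree F N) p r)
  | rtbtb (p r : Fin N × Fin N) :
      GlRel F q N (rttLHS F q (Tbfree F N) (Tbfree F N) p r)
        (rttRHS F q (Tbfree F N) (Tbfree F N) p r)
  | rtbt (p r : Fin N × Fin N) :
      GlRel F q N (rttLHS F q (Tbfree F N) (Tfree F N) p r)
        (rttRHS F q (Tbfree F N) (Tfree F N) p r)

/-- The quantized enveloping algebra `U_q(gl_N)`. -/
abbrev UqGl (F : Type) [Field F] (q : F) (N : ℕ) := RingQuot (GlRel F q N)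

def tE (F : Type) [Field F] (q : F) (N : ℕ) (i j : Fin N) : UqGl F q N :=
  RingQuot.mkAlgHom F (GlRel F q N) (FreeAlgebra.ι F (Sum.inl (i, j)))

def tbE (F : Type) [Field F] (q : F) (N : ℕ) (i j : Fin N) : UqGl F q N :=
  RingQuot.mkAlgHom F (GlRel F q N) (FreeAlgebra.ι F (Sum.inr (i, j)))

/-- The entries `s_ij = Σ_a t_ia t̄_ja` of `S = T T̄ᵗ`. -/
def sE (F : Type) [Field F] (q : F) (N : ℕ) (i j : Fin N) : UqGl F q N :=
  ∑ a : Fin N, tE F q N i a * tbE F q N j a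

/-- The twisted quantized enveloping algebra `U^tw_q(o_N)` as a subalgebra of `U_q(gl_N)`. -/
def UtwO (F : Type) [Field F] (q : F) (N : ℕ) : Subalgebra F (UqGl F q N) :=
  Algebra.adjoin F {x | ∃ i j, x = sE F q N i j}

/-! Symplectic (finite) case. -/

/-- `2k` as an element of `Fin (2n)` (the 0-based version of the odd index `2k-1`). -/
def fe (n : ℕ) (k : Fin n) : Fin (2 * n) := ⟨2 * k.val, by have := k.isLt; omega⟩

/-- `2k+1` as an element of `Fin (2n)` (the 0-based version of the even index `2k`). -/
def fo (n : ℕ) (k : Fin n) : Fin (2 * n) := ⟨2 * k.val + 1, by have := k.isLt; omega⟩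

/-- The entries `s_ij` of `S = T G T̄ᵗ` in `U_q(gl_2n)`. -/
def sSp (F : Type) [Field F] (q : F) (n : ℕ) (i j : Fin (2 * n)) : UqGl F q (2 * n) :=
  algebraMap F _ q * ∑ a : Fin n, tE F q (2 * n) i (fe n a) * tbE F q (2 * n) j (fo n a)
    - ∑ a : Fin n, tE F q (2 * n) i (fo n a) * tbE F q (2 * n) j (fe n a)

abbrev SpGen (n : ℕ) := (Fin (2 * n) × Fin (2 * n)) ⊕ Fin n

def SpFreeS (F : Type) [Field F] (n : ℕ) :
    Matrix (Fin (2 * n)) (Fin (2 * n)) (FreeAlgebra F (SpGen n)) :=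
  Matrix.of fun i j => FreeAlgebra.ι F (Sum.inl (i, j))

/-- Defining relations of the presented algebra `𝒮` of the symplectic case. -/
inductive SpRel (F : Type) [Field F] (q : F) (n : ℕ) :
    FreeAlgebra F (SpGen n) → FreeAlgebra F (SpGen n) → Prop
  | tri (i j : Fin (2 * n)) (h : i < j) (h' : ¬(i.val % 2 = 0 ∧ j.val = i.val + 1)) :
      SpRel F q n (FreeAlgebra.ι F (Sum.inl (i, j))) 0
  | quad (k : Fin n) :
      SpRel F q n
        (FreeAlgebra.ι F (Sum.inl (fo n k, fo n k)) * FreeAlgebra.ι F (Sum.inl (fe n k, fe n k)))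
        (algebraMap F _ (q ^ 2) *
            (FreeAlgebra.ι F (Sum.inl (fo n k, fe n k)) *
              FreeAlgebra.ι F (Sum.inl (fe n k, fo n k)))
          + algebraMap F _ (q ^ 3))
  | invR (k : Fin n) :
      SpRel F q n
        (FreeAlgebra.ι F (Sum.inl (fe n k, fo n k)) * FreeAlgebra.ι F (Sum.inr k)) 1
  | invL (k : Fin n) :
      SpRel F q n
        (FreeAlgebra.ι F (Sum.inr k) * FreeAlgebra.ι F (Sum.inl (fe n k, fo n k))) 1
  | refl (p r : Fin (2 * n) × Fin (2 * n)) :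
      SpRel F q n (reflLHS F q (SpFreeS F n) p r) (reflRHS F q (SpFreeS F n) p r)

abbrev AlgSp (F : Type) [Field F] (q : F) (n : ℕ) := RingQuot (SpRel F q n)

def sSpP (F : Type) [Field F] (q : F) (n : ℕ) (i j : Fin (2 * n)) : AlgSp F q n :=
  RingQuot.mkAlgHom F (SpRel F q n) (FreeAlgebra.ι F (Sum.inl (i, j)))

def sInvP (F : Type) [Field F] (q : F) (n : ℕ) (k : Fin n) : AlgSp F q n :=
  RingQuot.mkAlgHom F (SpRel F q n) (FreeAlgebra.ι F (Sum.inr k))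

/-- row `i = 2k` of the symplectic ordered monomial: positions `(i,0),…,(i,2k)`. -/
def rowA (n : ℕ) (k : Fin n) : List (Fin (2 * n) × Fin (2 * n)) :=
  ((List.finRange (2 * n)).filter fun j => j.val ≤ 2 * k.val).map fun j => (fe n k, j)

/-- row `i' = 2k+1` of the symplectic ordered monomial: positions `(i',0),…,(i',2k-1)`. -/
def rowB (n : ℕ) (k : Fin n) : List (Fin (2 * n) × Fin (2 * n)) :=
  ((List.finRange (2 * n)).filter fun j => j.val + 2 ≤ 2 * k.val + 1).map fun j => (fo n k, j)

/-- The ordered monomials of the symplectic case, with an arbitrary integer exponent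
on each `s_{i i'}` and nonnegative exponents elsewhere. -/
def monomSp {A : Type} [Ring A] (n : ℕ) (s : Fin (2 * n) × Fin (2 * n) → A) (sI : Fin n → A)
    (kN : Fin (2 * n) × Fin (2 * n) → ℕ) (kZ : Fin n → ℤ) : A :=
  ((List.finRange n).map fun k =>
    ((rowA n k).map fun p => s p ^ kN p).prod *
      (if 0 ≤ kZ k then s (fe n k, fo n k) ^ (kZ k).toNat else sI k ^ (-(kZ k)).toNat) *
      s (fo n k, fo n k) ^ kN (fo n k, fo n k) *
      ((rowB n k).map fun p => s p ^ kN p).prod).prod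

/-! Affine (twisted q-Yangian) machinery.  Series are treated coefficientwise. -/

/-- `z1 S r` is the coefficient matrix (in the first copy) of a series indexed by
nonnegative integers, extended by zero to `ℤ`. -/
def z1 {A : Type} [Ring A] {N : ℕ} (S : ℕ → Matrix (Fin N) (Fin N) A) (r : ℤ) :
    Matrix (Fin N × Fin N) (Fin N × Fin N) A :=
  if 0 ≤ r then amp1 (S r.toNat) else 0

def z2 {A : Type} [Ring A] {N : ℕ} (S : ℕ → Matrix (Fin N) (Fin N) A) (r : ℤ) :
    Matrix (Fin N × Fin N) (Fin N × Fin N) A :=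
  if 0 ≤ r then amp2 (S r.toNat) else 0

/-- Coefficient of `u^a v^b` in `R(u,v) S₁(u) Rᵗ(u⁻¹,v) S₂(v)`,
using `R(u,v) = u R̃ - v R` and `Rᵗ(u⁻¹,v) = u⁻¹ R̃ᵗ - v Rᵗ`. -/
def affLHS (F : Type) [Field F] (q : F) {N : ℕ} {A : Type} [Ring A] [Algebra F A]
    (S : ℕ → Matrix (Fin N) (Fin N) A) (a b : ℤ) :
    Matrix (Fin N × Fin N) (Fin N × Fin N) A :=
  liftF F (Rtil F q N) * z1 S (-a) * liftF F (Rtilt F q N) * z2 S (-b)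
    - liftF F (Rtil F q N) * z1 S (1 - a) * liftF F (Rct F q N) * z2 S (1 - b)
    - liftF F (Rc F q N) * z1 S (-1 - a) * liftF F (Rtilt F q N) * z2 S (1 - b)
    + liftF F (Rc F q N) * z1 S (-a) * liftF F (Rct F q N) * z2 S (2 - b)

/-- Coefficient of `u^a v^b` in `S₂(v) Rᵗ(u⁻¹,v) S₁(u) R(u,v)`. -/
def affRHS (F : Type) [Field F] (q : F) {N : ℕ} {A : Type} [Ring A] [Algebra F A]
    (S : ℕ → Matrix (Fin N) (Fin N) A) (a b : ℤ) :
    Matrix (Fin N × Fin N) (Fin N × Fin N) A :=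
  z2 S (-b) * liftF F (Rtilt F q N) * z1 S (-a) * liftF F (Rtil F q N)
    - z2 S (1 - b) * liftF F (Rtilt F q N) * z1 S (-1 - a) * liftF F (Rc F q N)
    - z2 S (1 - b) * liftF F (Rct F q N) * z1 S (1 - a) * liftF F (Rtil F q N)
    + z2 S (2 - b) * liftF F (Rct F q N) * z1 S (-a) * liftF F (Rc F q N)

def SfreeA (F : Type) [Field F] (N : ℕ) (r : ℕ) :
    Matrix (Fin N) (Fin N) (FreeAlgebra F (ℕ × Fin N × Fin N)) :=
  Matrix.of fun i j => FreeAlgebra.ι F (r, i, j)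

/-- Defining relations: only the affine reflection equation (coefficientwise). -/
inductive Rel9 (F : Type) [Field F] (q : F) (N : ℕ) :
    FreeAlgebra F (ℕ × Fin N × Fin N) → FreeAlgebra F (ℕ × Fin N × Fin N) → Prop
  | refl (a b : ℤ) (p r : Fin N × Fin N) :
      Rel9 F q N (affLHS F q (SfreeA F N) a b p r) (affRHS F q (SfreeA F N) a b p r)

abbrev Alg9 (F : Type) [Field F] (q : F) (N : ℕ) := RingQuot (Rel9 F q N)

def s9 (F : Type) [Field F] (q : F) (N : ℕ) (r : ℕ) (i j : Fin N) : Alg9 F q N :=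
  RingQuot.mkAlgHom F (Rel9 F q N) (FreeAlgebra.ι F (r, i, j))

/-- Defining relations of the presented twisted q-Yangian (orthogonal case). -/
inductive AORel (F : Type) [Field F] (q : F) (N : ℕ) :
    FreeAlgebra F (ℕ × Fin N × Fin N) → FreeAlgebra F (ℕ × Fin N × Fin N) → Prop
  | tri (i j : Fin N) (h : i < j) : AORel F q N (FreeAlgebra.ι F (0, i, j)) 0
  | diag (i : Fin N) : AORel F q N (FreeAlgebra.ι F (0, i, i)) 1
  | refl (a b : ℤ) (p r : Fin N × Fin N) :
      AORel F q N (affLHS F q (SfreeA F N) a b p r) (affRHS F q (SfreeA F N) a b p r)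

abbrev AlgAO (F : Type) [Field F] (q : F) (N : ℕ) := RingQuot (AORel F q N)

def sAO (F : Type) [Field F] (q : F) (N : ℕ) (r : ℕ) (i j : Fin N) : AlgAO F q N :=
  RingQuot.mkAlgHom F (AORel F q N) (FreeAlgebra.ι F (r, i, j))

/-- Lexicographic (non-strict) comparison of triples. -/
def tripLe (x y : ℕ × ℕ × ℕ) : Prop :=
  x.1 < y.1 ∨ (x.1 = y.1 ∧ (x.2.1 < y.2.1 ∨ (x.2.1 = y.2.1 ∧ x.2.2 ≤ y.2.2)))

/-- A list of generator indices `(r,i,j)` is ordered if it is weakly increasing with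
respect to the lexicographic order on `(r,i,j)`. -/
def sortedGens {N : ℕ} (l : List (ℕ × Fin N × Fin N)) : Prop :=
  l.Chain' fun x y => tripLe (x.1, x.2.1.val, x.2.2.val) (y.1, y.2.1.val, y.2.2.val)

/-! The quantum affine algebra `U_q(ĝl_N)` by its RTT presentation, coefficientwise. -/

abbrev AffGen (N : ℕ) := (ℕ × Fin N × Fin N) ⊕ (ℕ × Fin N × Fin N)

def TfA (F : Type) [Field F] (N : ℕ) (r : ℕ) :
    Matrix (Fin N) (Fin N) (FreeAlgebra F (AffGen N)) :=
  Matrix.of fun i j => FreeAlgebra.ι F (Sum.inl (r, i, j))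

def TbfA (F : Type) [Field F] (N : ℕ) (r : ℕ) :
    Matrix (Fin N) (Fin N) (FreeAlgebra F (AffGen N)) :=
  Matrix.of fun i j => FreeAlgebra.ι F (Sum.inr (r, i, j))

/-- Coefficient of `u^a v^b` in `R(u,v) X₁ Y₂` with prescribed coefficient extractions. -/
def affRttL (F : Type) [Field F] (q : F) {N : ℕ} {A : Type} [Ring A] [Algebra F A]
    (X Y : ℕ → Matrix (Fin N) (Fin N) A) (a b a' b' : ℤ) :
    Matrix (Fin N × Fin N) (Fin N × Fin N) A :=
  liftF F (Rtil F q N) * z1 X a * z2 Y b - liftF F (Rc F q N) * z1 X a' * z2 Y b'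

def affRttR (F : Type) [Field F] (q : F) {N : ℕ} {A : Type} [Ring A] [Algebra F A]
    (X Y : ℕ → Matrix (Fin N) (Fin N) A) (a b a' b' : ℤ) :
    Matrix (Fin N × Fin N) (Fin N × Fin N) A :=
  z2 Y b * z1 X a * liftF F (Rtil F q N) - z2 Y b' * z1 X a' * liftF F (Rc F q N)

inductive AffGlRel (F : Type) [Field F] (q : F) (N : ℕ) :
    FreeAlgebra F (AffGen N) → FreeAlgebra F (AffGen N) → Prop
  | t0_tri (i j : Fin N) (h : i < j) : AffGlRel F q N (TfA F N 0 i j) 0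
  | tb0_tri (i j : Fin N) (h : j < i) : AffGlRel F q N (TbfA F N 0 i j) 0
  | t_tb (i : Fin N) : AffGlRel F q N (TfA F N 0 i i * TbfA F N 0 i i) 1
  | tb_t (i : Fin N) : AffGlRel F q N (TbfA F N 0 i i * TfA F N 0 i i) 1
  | rtt (a b : ℤ) (p r : Fin N × Fin N) :
      AffGlRel F q N
        (affRttL F q (TfA F N) (TfA F N) (1 - a) (-b) (-a) (1 - b) p r)
        (affRttR F q (TfA F N) (TfA F N) (1 - a) (-b) (-a) (1 - b) p r)
  | rtbtb (a b : ℤ) (p r : Fin N × Fin N) :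
      AffGlRel F q N
        (affRttL F q (TbfA F N) (TbfA F N) (a - 1) b a (b - 1) p r)
        (affRttR F q (TbfA F N) (TbfA F N) (a - 1) b a (b - 1) p r)
  | rtbt (a b : ℤ) (p r : Fin N × Fin N) :
      AffGlRel F q N
        (affRttL F q (TbfA F N) (TfA F N) (a - 1) (-b) a (1 - b) p r)
        (affRttR F q (TbfA F N) (TfA F N) (a - 1) (-b) a (1 - b) p r)

/-- The quantum affine algebra `U_q(ĝl_N)`. -/
abbrev UqAff (F : Type) [Field F] (q : F) (N : ℕ) := RingQuot (AffGlRel F q N)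

def tA (F : Type) [Field F] (q : F) (N : ℕ) (r : ℕ) (i j : Fin N) : UqAff F q N :=
  RingQuot.mkAlgHom F (AffGlRel F q N) (FreeAlgebra.ι F (Sum.inl (r, i, j)))

def tbA (F : Type) [Field F] (q : F) (N : ℕ) (r : ℕ) (i j : Fin N) : UqAff F q N :=
  RingQuot.mkAlgHom F (AffGlRel F q N) (FreeAlgebra.ι F (Sum.inr (r, i, j)))

/-- Coefficient of `u^{-r}` in `s_ij(u) = Σ_a t_ia(u) t̄_ja(u⁻¹)`. -/
def Scoef (F : Type) [Field F] (q : F) (N : ℕ) (r : ℕ) (i j : Fin N) : UqAff F q N :=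
  ∑ a : Fin N, ∑ p ∈ Finset.range (r + 1), tA F q N p i a * tbA F q N (r - p) j a

/-- The twisted q-Yangian `Y^tw_q(o_N)` as a subalgebra of `U_q(ĝl_N)`. -/
def YtwO (F : Type) [Field F] (q : F) (N : ℕ) : Subalgebra F (UqAff F q N) :=
  Algebra.adjoin F {x | ∃ r i j, x = Scoef F q N r i j}

/-- Coefficient of `u^{-r}` in `s_ij(u)`, the `(i,j)` entry of `S(u) = T(u) G T̄(u⁻¹)ᵗ`
in the symplectic case. -/
def ScoefSp (F : Type) [Field F] (q : F) (n : ℕ) (r : ℕ) (i j : Fin (2 * n)) :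
    UqAff F q (2 * n) :=
  ∑ a : Fin n, ∑ p ∈ Finset.range (r + 1),
    (algebraMap F _ q * (tA F q (2 * n) p i (fe n a) * tbA F q (2 * n) (r - p) j (fo n a))
      - tA F q (2 * n) p i (fo n a) * tbA F q (2 * n) (r - p) j (fe n a))

/-- The twisted q-Yangian `Y^tw_q(sp_2n)` as a subalgebra of `U_q(ĝl_2n)`,
with a prescribed family of inverses of `s^{(0)}_{ii'}`. -/
def YtwSp (F : Type) [Field F] (q : F) (n : ℕ) (inv : Fin n → UqAff F q (2 * n)) :
    Subalgebra F (UqAff F q (2 * n)) :=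
  Algebra.adjoin F ({x | ∃ r i j, x = ScoefSp F q n r i j} ∪ Set.range inv)

abbrev ASpGen (n : ℕ) := (ℕ × Fin (2 * n) × Fin (2 * n)) ⊕ Fin n

def SfreeASp (F : Type) [Field F] (n : ℕ) (r : ℕ) :
    Matrix (Fin (2 * n)) (Fin (2 * n)) (FreeAlgebra F (ASpGen n)) :=
  Matrix.of fun i j => FreeAlgebra.ι F (Sum.inl (r, i, j))

/-- Defining relations of the presented twisted q-Yangian (symplectic case). -/
inductive ASpRel (F : Type) [Field F] (q : F) (n : ℕ) :
    FreeAlgebra F (ASpGen n) → FreeAlgebra F (ASpGen n) → Prop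
  | tri (i j : Fin (2 * n)) (h : i < j) (h' : ¬(i.val % 2 = 0 ∧ j.val = i.val + 1)) :
      ASpRel F q n (FreeAlgebra.ι F (Sum.inl (0, i, j))) 0
  | quad (k : Fin n) :
      ASpRel F q n
        (FreeAlgebra.ι F (Sum.inl (0, fo n k, fo n k)) *
          FreeAlgebra.ι F (Sum.inl (0, fe n k, fe n k)))
        (algebraMap F _ (q ^ 2) *
            (FreeAlgebra.ι F (Sum.inl (0, fo n k, fe n k)) *
              FreeAlgebra.ι F (Sum.inl (0, fe n k, fo n k)))
          + algebraMap F _ (q ^ 3))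
  | invR (k : Fin n) :
      ASpRel F q n
        (FreeAlgebra.ι F (Sum.inl (0, fe n k, fo n k)) * FreeAlgebra.ι F (Sum.inr k)) 1
  | invL (k : Fin n) :
      ASpRel F q n
        (FreeAlgebra.ι F (Sum.inr k) * FreeAlgebra.ι F (Sum.inl (0, fe n k, fo n k))) 1
  | refl (a b : ℤ) (p r : Fin (2 * n) × Fin (2 * n)) :
      ASpRel F q n (affLHS F q (SfreeASp F n) a b p r) (affRHS F q (SfreeASp F n) a b p r)

abbrev AlgASp (F : Type) [Field F] (q : F) (n : ℕ) := RingQuot (ASpRel F q n)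

def sASp (F : Type) [Field F] (q : F) (n : ℕ) (r : ℕ) (i j : Fin (2 * n)) : AlgASp F q n :=
  RingQuot.mkAlgHom F (ASpRel F q n) (FreeAlgebra.ι F (Sum.inl (r, i, j)))

def sInvASp (F : Type) [Field F] (q : F) (n : ℕ) (k : Fin n) : AlgASp F q n :=
  RingQuot.mkAlgHom F (ASpRel F q n) (FreeAlgebra.ι F (Sum.inr k))

/-! q-antisymmetrizer and Sklyanin/quantum determinant machinery. -/

/-- The trigonometric R-matrix `R(u,v)`. -/
def Rtrig (F : Type) [Field F] (q : F) (N : ℕ) (u v : F) :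
    Matrix (Fin N × Fin N) (Fin N × Fin N) F := Matrix.of fun p r =>
  (if p = r then (if p.1 = p.2 then q⁻¹ * u - q * v else u - v) else 0)
  + (if p.1 = r.2 ∧ p.2 = r.1 ∧ p.1 ≠ p.2 then
      (q⁻¹ - q) * (if p.2 < p.1 then u else v) else 0)

/-- An operator on `ℂ^N ⊗ ℂ^N` acting in the `i`-th and `j`-th factors of `(ℂ^N)^{⊗ r}`. -/
def big2 (F : Type) [Field F] {N r : ℕ} (i j : Fin r)
    (M : Matrix (Fin N × Fin N) (Fin N × Fin N) F) :
    Matrix (Fin r → Fin N) (Fin r → Fin N) F :=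
  Matrix.of fun f g =>
    if ∀ k, k ≠ i → k ≠ j → f k = g k then M (f i, f j) (g i, g j) else 0

/-- The list of the pairs `(i,j)`, `i < j`, in lexicographic order. -/
def pairsLex (r : ℕ) : List (Fin r × Fin r) :=
  (List.finRange r).flatMap fun i =>
    ((List.finRange r).filter fun j => i < j).map fun j => (i, j)

/-- The number of inversions (the Coxeter length) of a permutation. -/
def invCount {r : ℕ} (σ : Equiv.Perm (Fin r)) : ℕ :=
  (Finset.univ.filter fun p : Fin r × Fin r => p.1 < p.2 ∧ σ p.2 < σ p.1).card

/-- The q-permutation operator `P^q` on `ℂ^N ⊗ ℂ^N`. -/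
def PqSmall (F : Type) [Field F] (q : F) (N : ℕ) :
    Matrix (Fin N × Fin N) (Fin N × Fin N) F := Matrix.of fun p r =>
  if r.1 = p.2 ∧ r.2 = p.1 then (if p.1 = p.2 then 1 else if p.2 < p.1 then q else q⁻¹)
  else 0

/-- The hypothesis that `Pq` is the extension of the q-permutation operators along
reduced decompositions: `P^q_{σ s_i} = P^q_σ P^q_{s_i}` whenever the length grows. -/
def PqExt (F : Type) [Field F] (q : F) (N r : ℕ)
    (Pq : Equiv.Perm (Fin r) → Matrix (Fin r → Fin N) (Fin r → Fin N) F) : Prop :=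
  Pq 1 = 1 ∧
    ∀ (σ : Equiv.Perm (Fin r)) (i : ℕ) (h : i + 1 < r),
      invCount (σ * Equiv.swap ⟨i, Nat.lt_of_succ_lt h⟩ ⟨i + 1, h⟩) = invCount σ + 1 →
        Pq (σ * Equiv.swap ⟨i, Nat.lt_of_succ_lt h⟩ ⟨i + 1, h⟩) =
          Pq σ * big2 F ⟨i, Nat.lt_of_succ_lt h⟩ ⟨i + 1, h⟩ (PqSmall F q N)

/-- The q-antisymmetrizer `A^q_r = Σ_σ sgn(σ) P^q_σ`. -/
def AqM (F : Type) [Field F] {N r : ℕ}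
    (Pq : Equiv.Perm (Fin r) → Matrix (Fin r → Fin N) (Fin r → Fin N) F) :
    Matrix (Fin r → Fin N) (Fin r → Fin N) F :=
  ∑ σ : Equiv.Perm (Fin r), ((Equiv.Perm.sign σ : ℤ) : F) • Pq σ

/-- A matrix acting in the `k`-th factor of `(ℂ^N)^{⊗ N}`, with entries in `A`. -/
def ampAt {A : Type} [Ring A] {N : ℕ} (k : Fin N) (M : Matrix (Fin N) (Fin N) A) :
    Matrix (Fin N → Fin N) (Fin N → Fin N) A :=
  Matrix.of fun f g => if ∀ l, l ≠ k → f l = g l then M (f k) (g k) else 0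

/-- A scalar two-site operator viewed over `A`, acting at sites `i`, `j`. -/
def big2A (F : Type) [Field F] {A : Type} [Ring A] [Algebra F A] {N : ℕ} (i j : Fin N)
    (M : Matrix (Fin N × Fin N) (Fin N × Fin N) F) :
    Matrix (Fin N → Fin N) (Fin N → Fin N) A :=
  (big2 F i j M).map (algebraMap F A)

/-- Coefficient of `u^m` in a product of formal series, each of which is supported in
degrees `≤ 1`; the series are given by their coefficient functions `ℤ → M`. -/
def seriesProdCoeff {M : Type} [Ring M] : List (ℤ → M) → ℤ → M
  | [], m => if m = 0 then 1 else 0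
  | c :: t, m => ∑ k ∈ Finset.Icc (m - t.length) 1, c k * seriesProdCoeff t (m - k)

/-! Series factors entering the Sklyanin determinant. -/

/-- The matrix `S^{(r)}` of the coefficients of `S(u)` (orthogonal case). -/
def SmatA (F : Type) [Field F] (q : F) (N : ℕ) (r : ℕ) :
    Matrix (Fin N) (Fin N) (UqAff F q N) :=
  Matrix.of fun i j => Scoef F q N r i j

/-- The series `S_k(q^{-2k+2} u)` acting at site `k` (0-based `k`), coefficientwise. -/
def SfacO (F : Type) [Field F] (q : F) (N : ℕ) (k : Fin N) (m : ℤ) :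
    Matrix (Fin N → Fin N) (Fin N → Fin N) (UqAff F q N) :=
  if m ≤ 0 then q ^ (2 * (k.val : ℤ) * (-m)) • ampAt k (SmatA F q N (-m).toNat) else 0

/-- The series `R_{ij}ᵗ((q^{-2i+2}u)⁻¹, q^{-2j+2}u)` (0-based `i`, `j`), coefficientwise. -/
def RtfacO (F : Type) [Field F] (q : F) (N : ℕ) (i j : Fin N) (m : ℤ) :
    Matrix (Fin N → Fin N) (Fin N → Fin N) (UqAff F q N) :=
  if m = -1 then q ^ (2 * (i.val : ℤ)) • big2A F i j (Rtilt F q N)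
  else if m = 1 then (-(q ^ (-2 * (j.val : ℤ)))) • big2A F i j (Rct F q N)
  else 0

/-- The ordered list of factors `S₁(u) R₁₂ᵗ ⋯ R₁Nᵗ S₂(q⁻²u) ⋯ S_N(q^{-2N+2}u)`. -/
def sdetFacsO (F : Type) [Field F] (q : F) (N : ℕ) :
    List (ℤ → Matrix (Fin N → Fin N) (Fin N → Fin N) (UqAff F q N)) :=
  (List.finRange N).flatMap fun i =>
    SfacO F q N i :: (((List.finRange N).filter fun j => i < j).map fun j => RtfacO F q N i j)

/-- The matrix `S^{(r)}` of the coefficients of `S(u)` (symplectic case). -/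
def SmatASp (F : Type) [Field F] (q : F) (n : ℕ) (r : ℕ) :
    Matrix (Fin (2 * n)) (Fin (2 * n)) (UqAff F q (2 * n)) :=
  Matrix.of fun i j => ScoefSp F q n r i j

def SfacSp (F : Type) [Field F] (q : F) (n : ℕ) (k : Fin (2 * n)) (m : ℤ) :
    Matrix (Fin (2 * n) → Fin (2 * n)) (Fin (2 * n) → Fin (2 * n)) (UqAff F q (2 * n)) :=
  if m ≤ 0 then q ^ (2 * (k.val : ℤ) * (-m)) • ampAt k (SmatASp F q n (-m).toNat) else 0

def sdetFacsSp (F : Type) [Field F] (q : F) (n : ℕ) :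
    List (ℤ → Matrix (Fin (2 * n) → Fin (2 * n)) (Fin (2 * n) → Fin (2 * n))
      (UqAff F q (2 * n))) :=
  (List.finRange (2 * n)).flatMap fun i =>
    SfacSp F q n i ::
      (((List.finRange (2 * n)).filter fun j => i < j).map fun j => RtfacO F q (2 * n) i j)

/-- Coefficientwise quantum determinant `qdet T(u)`:
the coefficient of `u^m` (nonzero only for `m ≤ 0`). -/
def qdetTc (F : Type) [Field F] (q : F) (N : ℕ) (m : ℤ) : UqAff F q N :=
  if m ≤ 0 then
    ∑ σ : Equiv.Perm (Fin N), ∑ rv ∈ Finset.Nat.antidiagonalTuple N (-m).toNat,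
      (((-q)⁻¹ ^ invCount σ) * ∏ k : Fin N, q ^ (2 * (k.val : ℤ) * (rv k : ℤ))) •
        ((List.finRange N).map fun k => tA F q N (rv k) (σ k) k).prod
  else 0

/-- Coefficientwise quantum determinant `qdet T̄(q^{2N-2} u⁻¹)`:
the coefficient of `u^m` (nonzero only for `m ≤ 0`). -/
def qdetTbc (F : Type) [Field F] (q : F) (N : ℕ) (m : ℤ) : UqAff F q N :=
  if m ≤ 0 then
    ∑ σ : Equiv.Perm (Fin N), ∑ rv ∈ Finset.Nat.antidiagonalTuple N (-m).toNat,
      (((-q)⁻¹ ^ invCount σ) *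
          ∏ k : Fin N, q ^ ((2 * (N : ℤ) - 2 - 2 * (k.val : ℤ)) * (rv k : ℤ))) •
        ((List.finRange N).map fun k => tbA F q N (rv k) (σ k) k).prod
  else 0

/-- The linear factor `q^{2i-2}u⁻¹ - q^{-2j+2}u` of `γ_N(u)` (0-based `i`, `j`),
viewed as an `A`-valued series. -/
def gamFac (F : Type) [Field F] (q : F) (N : ℕ) (p : Fin N × Fin N) (m : ℤ) : UqAff F q N :=
  if m = -1 then algebraMap F _ (q ^ (2 * (p.1.val : ℤ)))
  else if m = 1 then algebraMap F _ (-(q ^ (-2 * (p.2.val : ℤ)))) else 0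

/-- The list of series whose product is `γ_N(u) qdet T(u) qdet T̄(q^{2N-2}u⁻¹)`
in the orthogonal case. -/
def rhsO (F : Type) [Field F] (q : F) (N : ℕ) : List (ℤ → UqAff F q N) :=
  ((pairsLex N).map fun p => gamFac F q N p) ++ [qdetTc F q N, qdetTbc F q N]

section ReflectionEntries

variable (F : Type) [Field F] (q : F) {N : ℕ} {A : Type} [Ring A] [Algebra F A]

/-- The diagonal weight `q ^ δ_ij`. -/
def diagWeight {F : Type} [Field F] (q : F) {N : ℕ} (i j : Fin N) : F := if i = j then q else 1

lemma diagWeight_ne_zero {q : F} (hq : q ≠ 0) (i j : Fin N) : diagWeight q i j ≠ 0 := by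
  unfold diagWeight
  split_ifs <;> simp [hq]

lemma liftF_Rc_mul_apply (M : Matrix (Fin N × Fin N) (Fin N × Fin N) A) (i j : Fin N)
    (x : Fin N × Fin N) :
    ((liftF F (Rc F q N) : Matrix _ _ A) * M) (i, j) x = diagWeight q i j • M (i, j) x
      + if i < j then (q - q⁻¹) • M (j, i) x else 0 := by
  rw [Matrix.mul_apply]
  have h : ∀ p : Fin N × Fin N, (liftF F (Rc F q N) : Matrix _ _ A) (i, j) p * M p x =
      (if p = (i, j) then diagWeight q i j • M (i, j) x else 0) +
      (if p = (j, i) then (if i < j then (q - q⁻¹) • M (j, i) x else 0) else 0) := by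
    rintro ⟨k, l⟩
    simp only [liftF, Rc, Matrix.map_apply, Matrix.of_apply, map_add, add_mul, ← Algebra.smul_def]
    congr 1
    · by_cases h : (k, l) = (i, j)
      · simp [h, diagWeight]
      · simp [h, Ne.symm h]
    · by_cases h : (k, l) = (j, i)
      · simp only [Prod.mk.injEq] at h
        obtain ⟨rfl, rfl⟩ := h
        by_cases h' : l < k <;> simp [h']
      · have h' : ¬ (i = l ∧ j = k ∧ i < j) := by
          rintro ⟨rfl, rfl, -⟩
          exact h rfl
        simp [h, h']
  simp [h, Finset.sum_add_distrib]

lemma mul_liftF_Rc_apply (M : Matrix (Fin N × Fin N) (Fin N × Fin N) A) (a b : Fin N)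
    (x : Fin N × Fin N) :
    (M * (liftF F (Rc F q N) : Matrix _ _ A)) x (a, b) = diagWeight q a b • M x (a, b)
      + if b < a then (q - q⁻¹) • M x (b, a) else 0 := by
  rw [Matrix.mul_apply]
  have h : ∀ p : Fin N × Fin N, M x p * (liftF F (Rc F q N) : Matrix _ _ A) p (a, b) =
      (if p = (a, b) then diagWeight q a b • M x (a, b) else 0) +
      (if p = (b, a) then (if b < a then (q - q⁻¹) • M x (b, a) else 0) else 0) := by
    rintro ⟨k, l⟩
    simp only [liftF, Rc, Matrix.map_apply, Matrix.of_apply, map_add, mul_add,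
      ← Algebra.commutes, ← Algebra.smul_def]
    congr 1
    · by_cases h : (k, l) = (a, b)
      · simp only [Prod.mk.injEq] at h
        simp [h, diagWeight]
      · simp [h]
    · by_cases h : (k, l) = (b, a)
      · simp only [Prod.mk.injEq] at h
        obtain ⟨rfl, rfl⟩ := h
        by_cases h' : k < l <;> simp [h']
      · have h' : ¬ (k = b ∧ l = a ∧ k < l) := by
          rintro ⟨rfl, rfl, -⟩
          exact h rfl
        simp [h, h']
  simp [h, Finset.sum_add_distrib]

lemma amp1_mul_apply (S : Matrix (Fin N) (Fin N) A)
    (M : Matrix (Fin N × Fin N) (Fin N × Fin N) A) (i j : Fin N) (x : Fin N × Fin N) :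
    (amp1 S * M) (i, j) x = ∑ m, S i m * M (m, j) x := by
  simp [Matrix.mul_apply, Fintype.sum_prod_type, amp1]

lemma mul_amp1_apply (S : Matrix (Fin N) (Fin N) A)
    (M : Matrix (Fin N × Fin N) (Fin N × Fin N) A) (a b : Fin N) (x : Fin N × Fin N) :
    (M * amp1 S) x (a, b) = ∑ m, M x (m, b) * S m a := by
  simp [Matrix.mul_apply, Fintype.sum_prod_type, amp1]

lemma liftF_Rct_mul_amp2_apply (S : Matrix (Fin N) (Fin N) A) (m l a b : Fin N) :
    ((liftF F (Rct F q N) : Matrix _ _ A) * amp2 S) (m, l) (a, b) =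
      (if m = a then diagWeight q a l • S l b else 0)
      + if m = l then (if a < l then (q - q⁻¹) • S a b else 0) else 0 := by
  simp only [Matrix.mul_apply, Fintype.sum_prod_type, amp2, liftF, Rct, Rc, diagWeight,
    Matrix.map_apply, Matrix.of_apply, mul_ite, mul_zero, Finset.sum_ite_irrel,
    Finset.sum_const_zero, Finset.sum_ite_eq', Finset.mem_univ, if_true, map_add, add_mul,
    Finset.sum_add_distrib, ← Algebra.smul_def]
  congr 1
  · by_cases h : m = a
    · subst h; simp
    · simp [h, Ne.symm h]
  · by_cases h : m = l
    · subst h; by_cases h' : a < m <;> simp [h']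
    · simp [h, Ne.symm h]

lemma amp2_mul_liftF_Rct_apply (S : Matrix (Fin N) (Fin N) A) (i j m b : Fin N) :
    (amp2 S * (liftF F (Rct F q N) : Matrix _ _ A)) (i, j) (m, b) =
      (if m = i then diagWeight q i b • S j b else 0)
      + if m = b then (if b < i then (q - q⁻¹) • S j i else 0) else 0 := by
  simp only [Matrix.mul_apply, Fintype.sum_prod_type, amp2, liftF, Rct, Rc, diagWeight,
    Matrix.map_apply, Matrix.of_apply, map_add, mul_add,
    Finset.sum_add_distrib, ← Algebra.commutes, ← Algebra.smul_def]
  congr 1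
  · by_cases h : m = i
    · subst h; simp
    · simp [h]
  · by_cases h : m = b
    · subst h; by_cases h' : m < i <;> simp [h', ite_and]
    · simp [h]

lemma reflLHS_apply (S : Matrix (Fin N) (Fin N) A) (i j a b : Fin N) :
    reflLHS F q S (i, j) (a, b) =
      diagWeight q i j • (diagWeight q a j • (S i a * S j b)
        + if a < j then (q - q⁻¹) • (S i j * S a b) else 0)
      + if i < j then (q - q⁻¹) • (diagWeight q a i • (S j a * S i b)
        + if a < i then (q - q⁻¹) • (S j i * S a b) else 0) else 0 := by
  simp only [reflLHS, Matrix.mul_assoc, liftF_Rc_mul_apply, amp1_mul_apply,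
    liftF_Rct_mul_amp2_apply, mul_add, mul_ite, mul_zero, Finset.sum_add_distrib,
    Finset.sum_ite_eq', Finset.mem_univ, if_true, mul_smul_comm]

lemma reflRHS_apply (S : Matrix (Fin N) (Fin N) A) (i j a b : Fin N) :
    reflRHS F q S (i, j) (a, b) =
      diagWeight q a b • (diagWeight q i b • (S j b * S i a)
        + if b < i then (q - q⁻¹) • (S j i * S b a) else 0)
      + if b < a then (q - q⁻¹) • (diagWeight q i a • (S j a * S i b)
        + if a < i then (q - q⁻¹) • (S j i * S a b) else 0) else 0 := by
  simp only [reflRHS, mul_liftF_Rc_apply, mul_amp1_apply,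
    amp2_mul_liftF_Rct_apply, add_mul, ite_mul, zero_mul, Finset.sum_add_distrib,
    Finset.sum_ite_eq', Finset.mem_univ, if_true, smul_mul_assoc]

end ReflectionEntries

section Straightening

variable (F : Type) [Field F] (q : F) (N : ℕ)

/-- The matrix of generators of `Alg0`. -/
def genMatrix : Matrix (Fin N) (Fin N) (Alg0 F q N) := Matrix.of (s0 F q N)

lemma reflection_equation (i j a b : Fin N) :
    reflLHS F q (genMatrix F q N) (i, j) (a, b) = reflRHS F q (genMatrix F q N) (i, j) (a, b) := by
  have h := RingQuot.mkAlgHom_rel F (Rel0.refl (F := F) (q := q) (i, j) (a, b))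
  simp only [reflLHS_apply, reflRHS_apply] at h ⊢
  simpa only [Sfree, genMatrix, s0, apply_ite (RingQuot.mkAlgHom F (Rel0 F q N)), map_add, map_smul, map_mul,
    map_zero, Matrix.of_apply] using h

/-- The span of the quadratic monomials `s_c s_d` whose row sum is less than `m`, or whose row
sum is `m` and whose first factor `c` satisfies `P c`. -/
def quadSpan (m : ℕ) (P : Fin N × Fin N → Prop) : Submodule F (Alg0 F q N) :=
  Submodule.span F {z | ∃ c d : Fin N × Fin N, z = s0 F q N c.1 c.2 * s0 F q N d.1 d.2 ∧
    ((c.1 : ℕ) + d.1 < m ∨ (c.1 : ℕ) + d.1 = m ∧ P c)}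

variable {F q N}

lemma mul_mem_quadSpan_of_lt {m : ℕ} {P : Fin N × Fin N → Prop} {i j a b : Fin N}
    (h : (i : ℕ) + j < m) : s0 F q N i a * s0 F q N j b ∈ quadSpan F q N m P :=
  Submodule.subset_span ⟨(i, a), (j, b), rfl, .inl h⟩

lemma mul_mem_quadSpan_of_eq {m : ℕ} {P : Fin N × Fin N → Prop} {i j a b : Fin N}
    (h : (i : ℕ) + j = m) (hP : P (i, a)) :
    s0 F q N i a * s0 F q N j b ∈ quadSpan F q N m P :=
  Submodule.subset_span ⟨(i, a), (j, b), rfl, .inr ⟨h, hP⟩⟩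

lemma ite_smul_mem {M : Type} [AddCommGroup M] [Module F M] (p : Submodule F M) (c : F) (x : M)
    (P : Prop) [Decidable P] (h : P → x ∈ p) : (if P then c • x else 0) ∈ p := by
  split_ifs with hP
  · exact p.smul_mem _ (h hP)
  · exact p.zero_mem

/-- Straightening of two generators in the same row. -/
lemma mul_mem_quadSpan_of_col_lt (hq : q ≠ 0) {i a b : Fin N} (hab : a < b) :
    s0 F q N i b * s0 F q N i a ∈ quadSpan F q N (i + i) (fun c => c.1 = i ∧ c.2 < b) := by
  set T := quadSpan F q N (i + i) (fun c => c.1 = i ∧ c.2 < b)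
  have h := reflection_equation F q N i i a b
  simp only [reflLHS_apply, reflRHS_apply, genMatrix, Matrix.of_apply, lt_irrefl, if_false,
    hab.not_gt, add_zero] at h
  have hw : diagWeight q a b = 1 := by simp [diagWeight, hab.ne]
  rw [hw, one_smul, ← sub_eq_iff_eq_add] at h
  rw [← Submodule.smul_mem_iff T (diagWeight_ne_zero F hq i b), ← h]
  refine T.sub_mem (T.smul_mem _ (T.add_mem (T.smul_mem _ ?_) (ite_smul_mem _ _ _ _ fun h' => ?_)))
    (ite_smul_mem _ _ _ _ fun h' => ?_)
  · exact mul_mem_quadSpan_of_eq rfl ⟨rfl, hab⟩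
  · exact mul_mem_quadSpan_of_lt (by lia)
  · exact mul_mem_quadSpan_of_lt (by lia)

/-- Straightening of two generators in rows `i < j`, with weakly decreasing columns. -/
lemma mul_mem_quadSpan_of_row_lt_of_col_le (hq : q ≠ 0) {i j a b : Fin N} (hij : i < j)
    (hba : b ≤ a) :
    s0 F q N j b * s0 F q N i a ∈ quadSpan F q N (j + i) (fun c => c.1 < j) := by
  set T := quadSpan F q N (j + i) (fun c => c.1 < j)
  have h := reflection_equation F q N i j a b
  simp only [reflLHS_apply, reflRHS_apply, genMatrix, Matrix.of_apply, if_pos hij] at h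
  have h₁ : s0 F q N i a * s0 F q N j b ∈ T := mul_mem_quadSpan_of_eq (by lia) hij
  have h₂ : (if a < j then (q - q⁻¹) • (s0 F q N i j * s0 F q N a b) else 0) ∈ T :=
    ite_smul_mem _ _ _ _ fun h' => mul_mem_quadSpan_of_lt (by lia)
  have h₃ : (if a < i then (q - q⁻¹) • (s0 F q N j i * s0 F q N a b) else 0) ∈ T :=
    ite_smul_mem _ _ _ _ fun h' => mul_mem_quadSpan_of_lt (by lia)
  have h₄ : (if b < i then (q - q⁻¹) • (s0 F q N j i * s0 F q N b a) else 0) ∈ T :=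
    ite_smul_mem _ _ _ _ fun h' => mul_mem_quadSpan_of_lt (by lia)
  generalize (if a < j then (q - q⁻¹) • (s0 F q N i j * s0 F q N a b) else 0) = y₂ at h h₂
  generalize (if a < i then (q - q⁻¹) • (s0 F q N j i * s0 F q N a b) else 0) = y₃ at h h₃
  generalize (if b < i then (q - q⁻¹) • (s0 F q N j i * s0 F q N b a) else 0) = y₄ at h h₄
  have hcomm : diagWeight q i a = diagWeight q a i := by simp [diagWeight, eq_comm]
  rcases hba.lt_or_eq with hlt | rfl
  · have hw : diagWeight q a b = 1 := by simp [diagWeight, hlt.ne']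
    rw [if_pos hlt, hcomm, add_left_inj, hw, one_smul, ← sub_eq_iff_eq_add] at h
    rw [← Submodule.smul_mem_iff T (diagWeight_ne_zero F hq i b), ← h]
    exact T.sub_mem (T.smul_mem _ (T.add_mem (T.smul_mem _ h₁) h₂)) h₄
  · rw [if_neg (lt_irrefl _), add_zero, hcomm] at h
    have hw : diagWeight q b b = q := by simp [diagWeight]
    rw [hw] at h
    have key : (q⁻¹ * diagWeight q b i) • (s0 F q N j b * s0 F q N i b) =
        diagWeight q i j • (diagWeight q b j • (s0 F q N i b * s0 F q N j b) + y₂)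
          + (q - q⁻¹) • y₃ - q • y₄ := by
      simp only [smul_add] at h
      linear_combination (norm := module) (-1 : F) • h
    rw [← Submodule.smul_mem_iff T (mul_ne_zero (inv_ne_zero hq) (diagWeight_ne_zero F hq b i)),
      key]
    exact T.sub_mem (T.add_mem (T.smul_mem _ (T.add_mem (T.smul_mem _ h₁) h₂)) (T.smul_mem _ h₃))
      (T.smul_mem _ h₄)

/-- Straightening of two generators in rows `i < j`. -/
lemma mul_mem_quadSpan_of_row_lt (hq : q ≠ 0) {i j : Fin N} (a b : Fin N) (hij : i < j) :
    s0 F q N j b * s0 F q N i a ∈ quadSpan F q N (j + i) (fun c => c.1 < j) := by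
  rcases le_or_gt b a with hba | hab
  · exact mul_mem_quadSpan_of_row_lt_of_col_le hq hij hba
  set T := quadSpan F q N (j + i) (fun c => c.1 < j)
  have h := reflection_equation F q N i j a b
  simp only [reflLHS_apply, reflRHS_apply, genMatrix, Matrix.of_apply, if_pos hij,
    if_neg hab.not_gt, add_zero] at h
  have hw : diagWeight q a b = 1 := by simp [diagWeight, hab.ne]
  rw [hw, one_smul, ← sub_eq_iff_eq_add] at h
  rw [← Submodule.smul_mem_iff T (diagWeight_ne_zero F hq i b), ← h]
  refine T.sub_mem (T.add_mem (T.smul_mem _ (T.add_mem (T.smul_mem _ ?_)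
    (ite_smul_mem _ _ _ _ fun h' => ?_))) (T.smul_mem _ (T.add_mem (T.smul_mem _ ?_)
    (ite_smul_mem _ _ _ _ fun h' => ?_)))) (ite_smul_mem _ _ _ _ fun h' => ?_)
  · exact mul_mem_quadSpan_of_eq (by lia) hij
  · exact mul_mem_quadSpan_of_lt (by lia)
  · exact mul_mem_quadSpan_of_row_lt_of_col_le hq hij hab.le
  · exact mul_mem_quadSpan_of_lt (by lia)
  · exact mul_mem_quadSpan_of_lt (by lia)

lemma quadSpan_mono {m : ℕ} {P Q : Fin N × Fin N → Prop} (h : ∀ c, P c → Q c) :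
    quadSpan F q N m P ≤ quadSpan F q N m Q := by
  refine Submodule.span_mono ?_
  rintro z ⟨c, d, rfl, h' | ⟨h', hP⟩⟩
  · exact ⟨c, d, rfl, .inl h'⟩
  · exact ⟨c, d, rfl, .inr ⟨h', h c hP⟩⟩

/-- A product of two generators in decreasing lexicographic order is a combination of products
that have smaller row sum, or the same row sum and a smaller first factor. -/
lemma mul_mem_quadSpan (hq : q ≠ 0) {x y : Fin N × Fin N} (hyx : toLex y < toLex x) :
    s0 F q N x.1 x.2 * s0 F q N y.1 y.2 ∈
      quadSpan F q N (x.1 + y.1) (fun c => toLex c < toLex x) := by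
  obtain ⟨j, b⟩ := x
  obtain ⟨i, a⟩ := y
  rcases Prod.Lex.toLex_lt_toLex.1 hyx with hij | ⟨rfl, hab⟩
  · exact quadSpan_mono (fun c hc => Prod.Lex.toLex_lt_toLex.2 (.inl hc))
      (mul_mem_quadSpan_of_row_lt hq a b hij)
  · exact quadSpan_mono (fun c hc => Prod.Lex.toLex_lt_toLex.2 (.inr hc))
      (mul_mem_quadSpan_of_col_lt hq hab)

end Straightening

section Words

variable {F : Type} [Field F] {q : F} {N : ℕ}

/-- The product of generators along a word. -/
def wordProd (F : Type) [Field F] (q : F) {N : ℕ} (w : List (Fin N × Fin N)) : Alg0 F q N :=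
  (w.map fun p => s0 F q N p.1 p.2).prod

lemma pairwise_lexPairs (N : ℕ) : (lexPairs N).Pairwise fun x y => toLex x < toLex y := by
  rw [lexPairs, List.pairwise_flatMap]
  constructor
  · intro i _
    rw [List.pairwise_map]
    refine (List.pairwise_lt_finRange N).imp ?_
    intro a b h
    exact Prod.Lex.toLex_lt_toLex.2 (.inr ⟨rfl, h⟩)
  · refine (List.pairwise_lt_finRange N).imp fun {i j} h => ?_
    simp only [List.mem_map]
    rintro _ ⟨a, -, rfl⟩ _ ⟨b, -, rfl⟩
    exact Prod.Lex.toLex_lt_toLex.2 (.inl h)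

lemma mem_lexPairs (p : Fin N × Fin N) : p ∈ lexPairs N := by
  simp [lexPairs]

lemma sum_map_eq_of_nodup {α : Type} [DecidableEq α] {l : List α} (hl : l.Nodup) {a : α}
    (ha : a ∈ l) {f : α → ℕ} (hf : ∀ x, x ≠ a → x ∈ l → f x = 0) : (l.map f).sum = f a := by
  rw [List.sum_map_eq_nsmul_single a f hf, List.count_eq_one_of_mem hl ha, one_smul]

lemma eq_flatMap_replicate_of_sorted {w : List (Fin N × Fin N)}
    (hw : w.Pairwise fun x y => toLex x ≤ toLex y) :
    w = (lexPairs N).flatMap fun p => List.replicate (w.count p) p := by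
  have hnd : (lexPairs N).Nodup := (pairwise_lexPairs N).imp fun h => by
    rintro rfl
    exact lt_irrefl _ h
  refine List.Perm.eq_of_pairwise (le := fun x y => toLex x ≤ toLex y)
    (fun a b _ _ h h' => toLex.injective (le_antisymm h h')) hw ?_ ?_
  · rw [List.pairwise_flatMap]
    refine ⟨fun p _ => ?_, (pairwise_lexPairs N).imp fun {x y} h => ?_⟩
    · simp [List.pairwise_replicate]
    · intro a ha b hb
      rw [List.eq_of_mem_replicate ha, List.eq_of_mem_replicate hb]
      exact h.le
  · rw [List.perm_iff_count]
    intro p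
    rw [List.count_flatMap, sum_map_eq_of_nodup hnd (mem_lexPairs p)]
    · simp
    · intro x hx _
      simp [List.count_replicate, hx]

lemma wordProd_of_sorted {w : List (Fin N × Fin N)}
    (hw : w.Pairwise fun x y => toLex x ≤ toLex y) :
    wordProd F q w = ((lexPairs N).map fun p => s0 F q N p.1 p.2 ^ w.count p).prod := by
  conv_lhs => rw [eq_flatMap_replicate_of_sorted hw]
  rw [wordProd, List.map_flatMap, List.flatMap_def, List.prod_flatten, List.map_map]
  simp [Function.comp_def]

/-- The sum of the row indices of a word. -/
def rowSum (w : List (Fin N × Fin N)) : ℕ := (w.map fun p => (p.1 : ℕ)).sum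

lemma wordProd_mem_of_sorted_mem (hq : q ≠ 0) {M : Submodule F (Alg0 F q N)}
    (hM : ∀ w : List (Fin N × Fin N), (w.Pairwise fun x y => toLex x ≤ toLex y) →
      wordProd F q w ∈ M) (w : List (Fin N × Fin N)) : wordProd F q w ∈ M := by
  have wf : WellFounded (List.Shortlex fun x y : Fin N × Fin N => toLex x < toLex y) :=
    List.Shortlex.wf (InvImage.wf toLex wellFounded_lt)
  induction hn : rowSum w using Nat.strong_induction_on generalizing w with
  | _ n ihn =>
  induction w using wf.induction with
  | _ w ihw =>
  subst hn
  by_cases hs : w.IsChain fun x y => toLex x ≤ toLex y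
  · have : IsTrans (Fin N × Fin N) fun x y => toLex x ≤ toLex y := ⟨fun _ _ _ => le_trans⟩
    exact hM w hs.pairwise
  simp only [List.isChain_iff_forall_rel_of_append_cons_cons, not_forall, not_le] at hs
  obtain ⟨x, y, u, v, rfl, hyx⟩ := hs
  let f : Alg0 F q N →ₗ[F] Alg0 F q N :=
    LinearMap.mulLeft F (wordProd F q u) ∘ₗ LinearMap.mulRight F (wordProd F q v)
  have hf : ∀ c d : Fin N × Fin N, f (s0 F q N c.1 c.2 * s0 F q N d.1 d.2) =
      wordProd F q (u ++ c :: d :: v) := by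
    intro c d
    simp [f, wordProd, mul_assoc]
  suffices h : quadSpan F q N (x.1 + y.1) (fun c => toLex c < toLex x) ≤ M.comap f by
    rw [← hf]
    exact h (mul_mem_quadSpan hq hyx)
  refine Submodule.span_le.2 ?_
  rintro _ ⟨c, d, rfl, h⟩
  change f _ ∈ M
  rw [hf]
  rcases h with h | ⟨h, hc⟩
  · exact ihn _ (by simp [rowSum]; lia) _ rfl
  · have hlt : List.Shortlex (fun x y : Fin N × Fin N => toLex x < toLex y)
        (c :: d :: v) (x :: y :: v) := .of_lex (by simp) (.rel hc)
    refine ihw (u ++ c :: d :: v) (hlt.append_left u) ?_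
    simp [rowSum]
    lia

lemma span_range_wordProd : Submodule.span F (Set.range (wordProd F q (N := N))) = ⊤ := by
  have hadj : Algebra.adjoin F (Set.range fun p : Fin N × Fin N => s0 F q N p.1 p.2) = ⊤ := by
    have h := congrArg (Subalgebra.map (RingQuot.mkAlgHom F (Rel0 F q N)))
      (FreeAlgebra.adjoin_range_ι F (Fin N × Fin N))
    rw [AlgHom.map_adjoin, ← Set.range_comp, Algebra.map_top,
      (AlgHom.range_eq_top _).2 (RingQuot.mkAlgHom_surjective F _)] at h
    exact h
  rw [eq_top_iff, ← Algebra.top_toSubmodule, ← hadj, Algebra.adjoin_eq_span]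
  refine Submodule.span_mono fun z hz => ?_
  obtain ⟨l, hl, rfl⟩ := Submonoid.exists_list_of_mem_closure hz
  have hl' : l ∈ Set.range (List.map fun p : Fin N × Fin N => s0 F q N p.1 p.2) := by
    rw [Set.range_list_map]
    exact hl
  obtain ⟨w, rfl⟩ := hl'
  exact ⟨w, rfl⟩

end Words

/-- In the algebra with generators `s_ij` and the reflection equation
`R S₁ Rᵗ S₂ = S₂ Rᵗ S₁ R` as defining relations, the ordered monomials
`s_11^{k_11} ⋯ s_NN^{k_NN}` (factors in lexicographic order of `(i,j)`) span the algebra. -/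
theorem stmt0 (F : Type) [Field F] (q : F) (hq : q ≠ 0) (N : ℕ) (hN : 1 ≤ N) :
    Submodule.span F
        {x : Alg0 F q N | ∃ k : Fin N × Fin N → ℕ,
          x = ((lexPairs N).map fun p => s0 F q N p.1 p.2 ^ k p).prod} = ⊤ := by
  rw [eq_top_iff, ← span_range_wordProd]
  refine Submodule.span_le.2 ?_
  rintro _ ⟨w, rfl⟩
  refine wordProd_mem_of_sorted_mem hq (fun w hw => ?_) w
  exact Submodule.subset_span ⟨fun p => w.count p, wordProd_of_sorted hw⟩
end
end

section
/- The abstract algebra 𝒮 over F = ℂ(q) generated by elements s_ij (1 ≤ i,j ≤ N) with defining relations s_ij = 0 for 1 ≤ i < j ≤ N, s_ii = 1 for 1 ≤ i ≤ N, and R S₁ Rᵗ S₂ = S₂ Rᵗ S₁ R for S = Σ s_ij ⊗ E_ij, is isomorphic to the twisted quantized enveloping algebra U^tw_q(o_N); an isomorphism is given by sending s_ij to the (i,j) entry Σ_{a=1}^N t_ia t̄_ja of T T̄ᵗ. -/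
noncomputable section

open scoped TensorProduct

/-! ### Amplifications and constant matrices -/

section Amp

variable {F : Type} [Field F] {q : F} {N : ℕ} {A : Type} [Ring A] [Algebra F A]

theorem amp1_mul (X Y : Matrix (Fin N) (Fin N) A) : amp1 (X * Y) = amp1 X * amp1 Y := by
  ext p r
  simp [amp1, Matrix.mul_apply, Fintype.sum_prod_type]

theorem amp2_mul (X Y : Matrix (Fin N) (Fin N) A) : amp2 (X * Y) = amp2 X * amp2 Y := by
  ext p r
  simp [amp2, Matrix.mul_apply, Fintype.sum_prod_type]

theorem amp1_mul_amp2_apply (X Y : Matrix (Fin N) (Fin N) A) (p r : Fin N × Fin N) :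
    (amp1 X * amp2 Y) p r = X p.1 r.1 * Y p.2 r.2 := by
  simp [amp1, amp2, Matrix.mul_apply, Fintype.sum_prod_type]

theorem amp2_mul_amp1_apply (X Y : Matrix (Fin N) (Fin N) A) (p r : Fin N × Fin N) :
    (amp2 Y * amp1 X) p r = Y p.2 r.2 * X p.1 r.1 := by
  simp [amp1, amp2, Matrix.mul_apply, Fintype.sum_prod_type]

theorem amp1_mul_amp2_comm {X Y : Matrix (Fin N) (Fin N) A}
    (h : ∀ i j k l, Commute (X i j) (Y k l)) : amp1 X * amp2 Y = amp2 Y * amp1 X := by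
  ext p r
  rw [amp1_mul_amp2_apply, amp2_mul_amp1_apply, (h _ _ _ _).eq]

theorem Rc_apply (i j k l : Fin N) : Rc F q N (i, j) (k, l) =
    (if i = k ∧ j = l then (if i = j then q else 1) else 0)
      + (if i = l ∧ j = k ∧ i < j then q - q⁻¹ else 0) := by
  simp [Rc, Prod.ext_iff]

theorem Rct_apply (i j k l : Fin N) : Rct F q N (i, j) (k, l) = Rc F q N (k, j) (i, l) := rfl

theorem Rc_swap (i j k l : Fin N) : Rc F q N (i, j) (k, l) = Rc F q N (l, k) (j, i) := by
  simp only [Rc_apply]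
  grind

theorem Rct_swap (i j k l : Fin N) : Rct F q N (i, j) (k, l) = Rct F q N (j, i) (l, k) := by
  simp only [Rct_apply, Rc_apply]
  grind

theorem sum_Rc_mul (i j : Fin N) (f : Fin N × Fin N → A) :
    ∑ k, algebraMap F A (Rc F q N (i, j) k) * f k
      = (if i = j then q else 1 : F) • f (i, j) + (if i < j then (q - q⁻¹) • f (j, i) else 0) := by
  simp only [Fintype.sum_prod_type, Rc_apply, ← Algebra.smul_def, add_smul,
    Finset.sum_add_distrib]
  congr 1
  · simp [ite_and, ite_smul]
  · by_cases h : i < j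
    · rw [Finset.sum_comm]
      simp [h, ite_and, ite_smul]
    · simp [h]

theorem sum_mul_Rc (k l : Fin N) (f : Fin N × Fin N → A) :
    ∑ p, f p * algebraMap F A (Rc F q N p (k, l))
      = (if k = l then q else 1 : F) • f (k, l) + (if l < k then (q - q⁻¹) • f (l, k) else 0) := by
  have h : ∀ p : Fin N × Fin N, f p * algebraMap F A (Rc F q N p (k, l))
      = algebraMap F A (Rc F q N (l, k) p.swap) * f p := fun p => by
    rw [← Algebra.commutes]
    exact congrArg (algebraMap F A · * f p) (Rc_swap _ _ _ _)
  rw [Fintype.sum_congr _ _ h]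
  have h' := (Equiv.prodComm (Fin N) (Fin N)).sum_comp
      (fun p => algebraMap F A (Rc F q N (l, k) p) * f p.swap)
  simp only [Equiv.prodComm_apply, Prod.swap_swap] at h'
  rw [h', sum_Rc_mul]
  simp [eq_comm]

theorem rttLHS_apply (X Y : Matrix (Fin N) (Fin N) A) (p r : Fin N × Fin N) :
    rttLHS F q X Y p r
      = ∑ k : Fin N × Fin N, algebraMap F A (Rc F q N p k) * (X k.1 r.1 * Y k.2 r.2) := by
  rw [rttLHS, Matrix.mul_assoc, Matrix.mul_apply]
  simp [amp1_mul_amp2_apply, liftF]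

theorem rttRHS_apply (X Y : Matrix (Fin N) (Fin N) A) (p r : Fin N × Fin N) :
    rttRHS F q X Y p r
      = ∑ k : Fin N × Fin N, Y p.2 k.2 * X p.1 k.1 * algebraMap F A (Rc F q N k r) := by
  rw [rttRHS, Matrix.mul_apply]
  simp [amp2_mul_amp1_apply, liftF]

theorem Rc_mul_Rct : Rc F q N * Rct F q N = Rct F q N * Rc F q N := by
  ext ⟨i, j⟩ ⟨k, l⟩
  have h1 := sum_Rc_mul (q := q) (A := F) i j (fun p => Rct F q N p (k, l))
  have h2 := sum_mul_Rc (q := q) (A := F) k l (fun p => Rct F q N (i, j) p)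
  simp only [Algebra.algebraMap_self, RingHom.id_apply] at h1 h2
  rw [Matrix.mul_apply, Matrix.mul_apply, h1, h2]
  simp only [Rct_apply, Rc_apply, smul_eq_mul]
  clear h1 h2
  rcases lt_trichotomy i j with h | rfl | h <;> rcases lt_trichotomy k l with h' | rfl | h'
  · simp only [h.ne, h'.ne, h, h'.not_gt, if_true, if_false]; grind
  · simp only [h.ne, h, lt_irrefl, if_true, if_false]; grind
  · simp only [h.ne, h'.ne', h, h', if_true, if_false]; grind
  · simp only [h'.ne, lt_irrefl, h'.not_gt, if_true, if_false]; grind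
  · simp only [lt_irrefl, if_true, if_false]
  · simp only [h'.ne', lt_irrefl, h', if_true, if_false]; grind
  · simp only [h.ne', h'.ne, h.not_gt, h'.not_gt, if_false]
  · simp only [h.ne', lt_irrefl, h.not_gt, if_true, if_false]; grind
  · simp only [h.ne', h'.ne', h.not_gt, h', if_true, if_false]; grind

theorem amp1_mul_apply_s1 (X : Matrix (Fin N) (Fin N) A)
    (M : Matrix (Fin N × Fin N) (Fin N × Fin N) A)
    (p r : Fin N × Fin N) : (amp1 X * M) p r = ∑ k, X p.1 k * M (k, p.2) r := by
  simp [amp1, Matrix.mul_apply, Fintype.sum_prod_type]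

theorem amp2_mul_apply (X : Matrix (Fin N) (Fin N) A)
    (M : Matrix (Fin N × Fin N) (Fin N × Fin N) A)
    (p r : Fin N × Fin N) : (amp2 X * M) p r = ∑ k, X p.2 k * M (p.1, k) r := by
  simp [amp2, Matrix.mul_apply, Fintype.sum_prod_type]

theorem mul_amp1_apply_s1 (X : Matrix (Fin N) (Fin N) A)
    (M : Matrix (Fin N × Fin N) (Fin N × Fin N) A)
    (p r : Fin N × Fin N) : (M * amp1 X) p r = ∑ k, M p (k, r.2) * X k r.1 := by
  simp [amp1, Matrix.mul_apply, Fintype.sum_prod_type]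

theorem mul_amp2_apply (X : Matrix (Fin N) (Fin N) A)
    (M : Matrix (Fin N × Fin N) (Fin N × Fin N) A)
    (p r : Fin N × Fin N) : (M * amp2 X) p r = ∑ k, M p (r.1, k) * X k r.2 := by
  simp [amp2, Matrix.mul_apply, Fintype.sum_prod_type]

end Amp

/-! ### The reflection equation for `T T̄ᵗ` -/

section Reflection

variable {F : Type} [Field F] {q : F} {N : ℕ} {A : Type} [Ring A] [Algebra F A]

theorem amp1_mul_Rct_mul_amp2_apply (X Y : Matrix (Fin N) (Fin N) A) (p r : Fin N × Fin N) :
    (amp1 X.transpose * liftF F (Rct F q N) * amp2 Y : Matrix _ _ A) p r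
      = rttLHS F q X Y (r.1, p.2) (p.1, r.2) := by
  rw [rttLHS_apply, mul_amp2_apply, Fintype.sum_prod_type, Finset.sum_comm]
  simp only [amp1_mul_apply_s1, Finset.sum_mul]
  refine Finset.sum_congr rfl fun l _ => Finset.sum_congr rfl fun k _ => ?_
  rw [← mul_assoc, Algebra.commutes]
  rfl

theorem amp2_mul_Rct_mul_amp1_apply (X Y : Matrix (Fin N) (Fin N) A) (p r : Fin N × Fin N) :
    (amp2 Y * liftF F (Rct F q N) * amp1 X.transpose : Matrix _ _ A) p r
      = rttRHS F q X Y (r.1, p.2) (p.1, r.2) := by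
  rw [rttRHS_apply, mul_amp1_apply_s1, Fintype.sum_prod_type]
  simp only [amp2_mul_apply, Finset.sum_mul]
  refine Finset.sum_congr rfl fun l _ => Finset.sum_congr rfl fun k _ => ?_
  rw [mul_assoc, mul_assoc, ← Algebra.commutes]
  rfl

theorem amp2_mul_Rct_mul_amp1_apply' (X Y : Matrix (Fin N) (Fin N) A) (p r : Fin N × Fin N) :
    (amp2 X.transpose * liftF F (Rct F q N) * amp1 Y : Matrix _ _ A) p r
      = rttLHS F q X Y (r.2, p.1) (p.2, r.1) := by
  rw [rttLHS_apply, mul_amp1_apply_s1, Fintype.sum_prod_type, Finset.sum_comm]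
  simp only [amp2_mul_apply, Finset.sum_mul]
  refine Finset.sum_congr rfl fun l _ => Finset.sum_congr rfl fun k _ => ?_
  rw [← mul_assoc, Algebra.commutes, Rc_swap]
  simp only [liftF, Matrix.map_apply, Rct_swap p.1, Rct_apply, Rc_swap r.2]
  rfl

theorem amp1_mul_Rct_mul_amp2_apply' (X Y : Matrix (Fin N) (Fin N) A) (p r : Fin N × Fin N) :
    (amp1 Y * liftF F (Rct F q N) * amp2 X.transpose : Matrix _ _ A) p r
      = rttRHS F q X Y (r.2, p.1) (p.2, r.1) := by
  rw [rttRHS_apply, mul_amp2_apply, Fintype.sum_prod_type]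
  simp only [amp1_mul_apply_s1, Finset.sum_mul]
  refine Finset.sum_congr rfl fun l _ => Finset.sum_congr rfl fun k _ => ?_
  rw [mul_assoc, mul_assoc, ← Algebra.commutes]
  simp only [liftF, Matrix.map_apply, Rct_swap k, Rct_apply]
  rfl

theorem rttLHS_transpose_apply (X Y : Matrix (Fin N) (Fin N) A) (p r : Fin N × Fin N) :
    (liftF F (Rc F q N) * amp1 X.transpose * amp2 Y.transpose : Matrix _ _ A) p r
      = rttRHS F q Y X r.swap p.swap := by
  rw [rttRHS_apply, Matrix.mul_assoc, Matrix.mul_apply, Fintype.sum_prod_type, Fintype.sum_prod_type,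
    Finset.sum_comm]
  refine Finset.sum_congr rfl fun l _ => Finset.sum_congr rfl fun k _ => ?_
  rw [amp1_mul_amp2_apply, ← Algebra.commutes (Rc F q N (l, k) p.swap), Prod.swap,
    Rc_swap]
  rfl

theorem rttRHS_transpose_apply (X Y : Matrix (Fin N) (Fin N) A) (p r : Fin N × Fin N) :
    (amp2 Y.transpose * amp1 X.transpose * liftF F (Rc F q N) : Matrix _ _ A) p r
      = rttLHS F q Y X r.swap p.swap := by
  rw [rttLHS_apply, Matrix.mul_apply, Fintype.sum_prod_type, Fintype.sum_prod_type,
    Finset.sum_comm]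
  refine Finset.sum_congr rfl fun l _ => Finset.sum_congr rfl fun k _ => ?_
  rw [amp2_mul_amp1_apply, Algebra.commutes, Prod.swap, Rc_swap]
  rfl

/-- If `T`, `T̄` satisfy the RTT relations, then `T T̄ᵗ` satisfies the reflection equation. -/
theorem reflLHS_mul_transpose {T Tb : Matrix (Fin N) (Fin N) A}
    (h₁ : rttLHS F q T T = rttRHS F q T T) (h₂ : rttLHS F q Tb Tb = rttRHS F q Tb Tb)
    (h₃ : rttLHS F q Tb T = rttRHS F q Tb T) :
    reflLHS F q (T * Tb.transpose) = reflRHS F q (T * Tb.transpose) := by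
  have e₁ : amp1 Tb.transpose * liftF F (Rct F q N) * amp2 T
      = amp2 T * liftF F (Rct F q N) * amp1 Tb.transpose := by
    ext p r
    rw [amp1_mul_Rct_mul_amp2_apply, amp2_mul_Rct_mul_amp1_apply, h₃]
  have e₂ : amp2 Tb.transpose * liftF F (Rct F q N) * amp1 T
      = amp1 T * liftF F (Rct F q N) * amp2 Tb.transpose := by
    ext p r
    rw [amp2_mul_Rct_mul_amp1_apply', amp1_mul_Rct_mul_amp2_apply', h₃]
  have e₃ : liftF F (Rc F q N) * amp1 Tb.transpose * amp2 Tb.transpose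
      = amp2 Tb.transpose * amp1 Tb.transpose * liftF F (Rc F q N) := by
    ext p r
    rw [rttLHS_transpose_apply, rttRHS_transpose_apply, h₂]
  have e₄ : (liftF F (Rc F q N) * liftF F (Rct F q N) : Matrix _ _ A)
      = liftF F (Rct F q N) * liftF F (Rc F q N) := by
    simp only [liftF]
    rw [← Matrix.map_mul, ← Matrix.map_mul, Rc_mul_Rct]
  rw [rttLHS, rttRHS] at h₁
  rw [reflLHS, reflRHS, amp1_mul, amp2_mul]
  calc _ = liftF F (Rc F q N) * amp1 T * (amp1 Tb.transpose * liftF F (Rct F q N) * amp2 T)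
        * amp2 Tb.transpose := by simp only [Matrix.mul_assoc]
    _ = (liftF F (Rc F q N) * amp1 T * amp2 T) * liftF F (Rct F q N)
        * amp1 Tb.transpose * amp2 Tb.transpose := by rw [e₁]; simp only [Matrix.mul_assoc]
    _ = amp2 T * amp1 T * (liftF F (Rc F q N) * liftF F (Rct F q N))
        * amp1 Tb.transpose * amp2 Tb.transpose := by rw [h₁]; simp only [Matrix.mul_assoc]
    _ = amp2 T * amp1 T * liftF F (Rct F q N)
        * (liftF F (Rc F q N) * amp1 Tb.transpose * amp2 Tb.transpose) := by
      rw [e₄]; simp only [Matrix.mul_assoc]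
    _ = amp2 T * (amp1 T * liftF F (Rct F q N) * amp2 Tb.transpose)
        * amp1 Tb.transpose * liftF F (Rc F q N) := by rw [e₃]; simp only [Matrix.mul_assoc]
    _ = _ := by rw [← e₂]; simp only [Matrix.mul_assoc]

end Reflection

/-! ### Pairs of matrices satisfying the RTT relations -/

section RTT

/-- The defining relations of `U_q(gl_N)` for a pair of matrices over an `F`-algebra. -/
structure IsRTT {F : Type} [Field F] (q : F) {N : ℕ} {A : Type} [Ring A] [Algebra F A]
    (T Tb : Matrix (Fin N) (Fin N) A) : Prop where
  t_zero : ∀ i j, i < j → T i j = 0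
  tb_zero : ∀ i j, j < i → Tb i j = 0
  t_tb : ∀ i, T i i * Tb i i = 1
  tb_t : ∀ i, Tb i i * T i i = 1
  rtt : rttLHS F q T T = rttRHS F q T T
  rtbtb : rttLHS F q Tb Tb = rttRHS F q Tb Tb
  rtbt : rttLHS F q Tb T = rttRHS F q Tb T

variable {F : Type} [Field F] {q : F} {N : ℕ} {A B : Type} [Ring A] [Algebra F A]
  [Ring B] [Algebra F B]

theorem amp1_map (f : A →ₐ[F] B) (X : Matrix (Fin N) (Fin N) A) :
    (amp1 X).map f = amp1 (X.map f) := by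
  ext p r
  simp only [amp1, Matrix.map_apply, Matrix.of_apply]
  split_ifs <;> simp

theorem amp2_map (f : A →ₐ[F] B) (X : Matrix (Fin N) (Fin N) A) :
    (amp2 X).map f = amp2 (X.map f) := by
  ext p r
  simp only [amp2, Matrix.map_apply, Matrix.of_apply]
  split_ifs <;> simp

theorem liftF_map (f : A →ₐ[F] B) {m : Type} (X : Matrix m m F) :
    (liftF F X : Matrix m m A).map f = liftF F X := by
  ext p r
  simp [liftF]

theorem rttLHS_map (f : A →ₐ[F] B) (X Y : Matrix (Fin N) (Fin N) A) :
    (rttLHS F q X Y).map f = rttLHS F q (X.map f) (Y.map f) := by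
  simp only [rttLHS, Matrix.map_mul, amp1_map, amp2_map, liftF_map]

theorem map_rttLHS_apply (f : A →ₐ[F] B) (X Y : Matrix (Fin N) (Fin N) A)
    (p r : Fin N × Fin N) :
    f (rttLHS F q X Y p r) = rttLHS F q (X.map f) (Y.map f) p r :=
  congrFun (congrFun (rttLHS_map f X Y) p) r

theorem rttRHS_map (f : A →ₐ[F] B) (X Y : Matrix (Fin N) (Fin N) A) :
    (rttRHS F q X Y).map f = rttRHS F q (X.map f) (Y.map f) := by
  simp only [rttRHS, Matrix.map_mul, amp1_map, amp2_map, liftF_map]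

theorem map_rttRHS_apply (f : A →ₐ[F] B) (X Y : Matrix (Fin N) (Fin N) A)
    (p r : Fin N × Fin N) :
    f (rttRHS F q X Y p r) = rttRHS F q (X.map f) (Y.map f) p r :=
  congrFun (congrFun (rttRHS_map f X Y) p) r

theorem reflLHS_map (f : A →ₐ[F] B) (X : Matrix (Fin N) (Fin N) A) :
    (reflLHS F q X).map f = reflLHS F q (X.map f) := by
  simp only [reflLHS, Matrix.map_mul, amp1_map, amp2_map, liftF_map]

theorem map_reflLHS_apply (f : A →ₐ[F] B) (X : Matrix (Fin N) (Fin N) A)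
    (p r : Fin N × Fin N) :
    f (reflLHS F q X p r) = reflLHS F q (X.map f) p r :=
  congrFun (congrFun (reflLHS_map f X) p) r

theorem reflRHS_map (f : A →ₐ[F] B) (X : Matrix (Fin N) (Fin N) A) :
    (reflRHS F q X).map f = reflRHS F q (X.map f) := by
  simp only [reflRHS, Matrix.map_mul, amp1_map, amp2_map, liftF_map]

theorem map_reflRHS_apply (f : A →ₐ[F] B) (X : Matrix (Fin N) (Fin N) A)
    (p r : Fin N × Fin N) :
    f (reflRHS F q X p r) = reflRHS F q (X.map f) p r :=
  congrFun (congrFun (reflRHS_map f X) p) r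

theorem rttLHS_mul {X Y X' Y' : Matrix (Fin N) (Fin N) A}
    (h : rttLHS F q X Y = rttRHS F q X Y) (h' : rttLHS F q X' Y' = rttRHS F q X' Y')
    (hc : ∀ i j k l, Commute (X' i j) (Y k l)) (hc' : ∀ i j k l, Commute (X i j) (Y' k l)) :
    rttLHS F q (X * X') (Y * Y') = rttRHS F q (X * X') (Y * Y') := by
  have e₁ := amp1_mul_amp2_comm hc
  have e₂ := amp1_mul_amp2_comm hc'
  rw [rttLHS, rttRHS] at h h'
  rw [rttLHS, rttRHS, amp1_mul, amp2_mul]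
  calc _ = liftF F (Rc F q N) * amp1 X * (amp1 X' * amp2 Y) * amp2 Y' := by
        simp only [Matrix.mul_assoc]
    _ = (liftF F (Rc F q N) * amp1 X * amp2 Y) * amp1 X' * amp2 Y' := by
        rw [e₁]; simp only [Matrix.mul_assoc]
    _ = amp2 Y * amp1 X * (liftF F (Rc F q N) * amp1 X' * amp2 Y') := by
        rw [h]; simp only [Matrix.mul_assoc]
    _ = amp2 Y * (amp1 X * amp2 Y') * amp1 X' * liftF F (Rc F q N) := by
        rw [h']; simp only [Matrix.mul_assoc]
    _ = _ := by rw [e₂]; simp only [Matrix.mul_assoc]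

theorem mul_apply_of_lower {X Y : Matrix (Fin N) (Fin N) A} (hX : ∀ i j, i < j → X i j = 0)
    (hY : ∀ i j, i < j → Y i j = 0) {i j : Fin N} (h : i ≤ j) :
    (X * Y) i j = if i = j then X i i * Y i i else 0 := by
  rw [Matrix.mul_apply]
  have key : ∀ k, k ≠ i ∨ i ≠ j → X i k * Y k j = 0 := fun k hk => by
    rcases lt_trichotomy i k with h1 | rfl | h1
    · rw [hX _ _ h1, zero_mul]
    · rw [hY _ _ (lt_of_le_of_ne h (by tauto)), mul_zero]
    · rw [hY _ _ (h1.trans_le h), mul_zero]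
  split_ifs with hij
  · subst hij
    exact Finset.sum_eq_single _ (fun k _ hk => key k (.inl hk)) (by simp)
  · exact Finset.sum_eq_zero fun k _ => key k (.inr hij)

theorem mul_apply_of_upper {X Y : Matrix (Fin N) (Fin N) A} (hX : ∀ i j, j < i → X i j = 0)
    (hY : ∀ i j, j < i → Y i j = 0) {i j : Fin N} (h : j ≤ i) :
    (X * Y) i j = if i = j then X i i * Y i i else 0 := by
  rw [Matrix.mul_apply]
  have key : ∀ k, k ≠ i ∨ i ≠ j → X i k * Y k j = 0 := fun k hk => by
    rcases lt_trichotomy k i with h1 | rfl | h1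
    · rw [hX _ _ h1, zero_mul]
    · rw [hY _ _ (lt_of_le_of_ne h (by tauto)), mul_zero]
    · rw [hY _ _ (h.trans_lt h1), mul_zero]
  split_ifs with hij
  · subst hij
    exact Finset.sum_eq_single _ (fun k _ hk => key k (.inl hk)) (by simp)
  · exact Finset.sum_eq_zero fun k _ => key k (.inr hij)

namespace IsRTT

theorem map {T Tb : Matrix (Fin N) (Fin N) A} (h : IsRTT q T Tb) (f : A →ₐ[F] B) :
    IsRTT q (T.map f) (Tb.map f) where
  t_zero i j hij := by simp [h.t_zero i j hij]
  tb_zero i j hij := by simp [h.tb_zero i j hij]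
  t_tb i := by simp [← map_mul, h.t_tb]
  tb_t i := by simp [← map_mul, h.tb_t]
  rtt := by rw [← rttLHS_map, h.rtt, rttRHS_map]
  rtbtb := by rw [← rttLHS_map, h.rtbtb, rttRHS_map]
  rtbt := by rw [← rttLHS_map, h.rtbt, rttRHS_map]

theorem mul {L Lb T Tb : Matrix (Fin N) (Fin N) A} (h : IsRTT q L Lb) (h' : IsRTT q T Tb)
    (h₁ : ∀ i j k l, Commute (L i j) (T k l)) (h₂ : ∀ i j k l, Commute (L i j) (Tb k l))
    (h₃ : ∀ i j k l, Commute (Lb i j) (T k l)) (h₄ : ∀ i j k l, Commute (Lb i j) (Tb k l)) :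
    IsRTT q (L * T) (Lb * Tb) where
  t_zero i j hij := by rw [mul_apply_of_lower h.t_zero h'.t_zero hij.le, if_neg hij.ne]
  tb_zero i j hij := by rw [mul_apply_of_upper h.tb_zero h'.tb_zero hij.le, if_neg hij.ne']
  t_tb i := by
    rw [mul_apply_of_lower h.t_zero h'.t_zero le_rfl, if_pos rfl,
      mul_apply_of_upper h.tb_zero h'.tb_zero le_rfl, if_pos rfl, ← mul_assoc, mul_assoc (L i i),
      ← (h₃ _ _ _ _).eq, ← mul_assoc, h.t_tb, one_mul, h'.t_tb]
  tb_t i := by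
    rw [mul_apply_of_lower h.t_zero h'.t_zero le_rfl, if_pos rfl,
      mul_apply_of_upper h.tb_zero h'.tb_zero le_rfl, if_pos rfl, ← mul_assoc, mul_assoc (Lb i i),
      ← (h₂ _ _ _ _).eq, ← mul_assoc, h.tb_t, one_mul, h'.tb_t]
  rtt := rttLHS_mul h.rtt h'.rtt (fun _ _ _ _ => (h₁ _ _ _ _).symm) h₁
  rtbtb := rttLHS_mul h.rtbtb h'.rtbtb (fun _ _ _ _ => (h₄ _ _ _ _).symm) h₄
  rtbt := rttLHS_mul h.rtbt h'.rtbt (fun _ _ _ _ => (h₂ _ _ _ _).symm) h₃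

/-- The homomorphism out of `U_q(gl_N)` defined by a pair of matrices. -/
def lift {T Tb : Matrix (Fin N) (Fin N) A} (h : IsRTT q T Tb) : UqGl F q N →ₐ[F] A :=
  RingQuot.liftAlgHom F
    ⟨FreeAlgebra.lift F (Sum.elim (fun p => T p.1 p.2) fun p => Tb p.1 p.2), by
      have hT : (Tfree F N).map (FreeAlgebra.lift F
          (Sum.elim (fun p => T p.1 p.2) fun p => Tb p.1 p.2)) = T := by
        ext i j; simp [Tfree]
      have hTb : (Tbfree F N).map (FreeAlgebra.lift F
          (Sum.elim (fun p => T p.1 p.2) fun p => Tb p.1 p.2)) = Tb := by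
        ext i j; simp [Tbfree]
      intro x y hxy
      cases hxy with
      | t_zero i j hij => simpa [Tfree] using h.t_zero i j hij
      | tb_zero i j hij => simpa [Tbfree] using h.tb_zero i j hij
      | t_tb i => simpa [Tfree, Tbfree] using h.t_tb i
      | tb_t i => simpa [Tfree, Tbfree] using h.tb_t i
      | rtt p r =>
        rw [map_rttLHS_apply, map_rttRHS_apply, hT, h.rtt]
      | rtbtb p r =>
        rw [map_rttLHS_apply, map_rttRHS_apply, hTb, h.rtbtb]
      | rtbt p r =>
        rw [map_rttLHS_apply, map_rttRHS_apply, hT, hTb, h.rtbt]⟩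

theorem lift_tE {T Tb : Matrix (Fin N) (Fin N) A} (h : IsRTT q T Tb) (i j : Fin N) :
    h.lift (tE F q N i j) = T i j := by
  simp [lift, tE]

theorem lift_tbE {T Tb : Matrix (Fin N) (Fin N) A} (h : IsRTT q T Tb) (i j : Fin N) :
    h.lift (tbE F q N i j) = Tb i j := by
  simp [lift, tbE]

theorem lift_sE {T Tb : Matrix (Fin N) (Fin N) A} (h : IsRTT q T Tb) (i j : Fin N) :
    h.lift (sE F q N i j) = (T * Tb.transpose) i j := by
  simp [sE, lift_tE, lift_tbE, Matrix.mul_apply]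

end IsRTT

theorem isRTT_tE : IsRTT q (Matrix.of (tE F q N)) (Matrix.of (tbE F q N)) := by
  have key {x y} (h : GlRel F q N x y) := RingQuot.mkAlgHom_rel F h
  have hT : Matrix.of (tE F q N) = (Tfree F N).map (RingQuot.mkAlgHom F (GlRel F q N)) := rfl
  have hTb : Matrix.of (tbE F q N) = (Tbfree F N).map (RingQuot.mkAlgHom F (GlRel F q N)) := rfl
  rw [hT, hTb]
  constructor
  · intro i j h; simpa using key (.t_zero i j h)
  · intro i j h; simpa using key (.tb_zero i j h)
  · intro i; simpa using key (.t_tb i)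
  · intro i; simpa using key (.tb_t i)
  · rw [← rttLHS_map, ← rttRHS_map]; ext p r; exact key (.rtt p r)
  · rw [← rttLHS_map, ← rttRHS_map]; ext p r; exact key (.rtbtb p r)
  · rw [← rttLHS_map, ← rttRHS_map]; ext p r; exact key (.rtbt p r)

theorem sE_eq_mul_transpose (i j : Fin N) :
    sE F q N i j = (Matrix.of (tE F q N) * (Matrix.of (tbE F q N)).transpose) i j := by
  simp [sE, Matrix.mul_apply]

theorem sE_of_le {i j : Fin N} (h : i ≤ j) : sE F q N i j = if i = j then 1 else 0 := by
  have H : IsRTT q (Matrix.of (tE F q N)) (Matrix.of (tbE F q N)) := isRTT_tE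
  rw [sE_eq_mul_transpose, mul_apply_of_lower (Y := (Matrix.of (tbE F q N)).transpose) H.t_zero
    (fun i j h => H.tb_zero j i h) h]
  simp only [Matrix.transpose_apply, H.t_tb]

end RTT

/-! ### The homomorphism from the reflection equation algebra -/

section Hom

variable {F : Type} [Field F] {q : F} {N : ℕ}

theorem sOS_of_le {i j : Fin N} (h : i ≤ j) : sOS F q N i j = if i = j then 1 else 0 := by
  rcases h.eq_or_lt with rfl | h
  · simpa [sOS] using RingQuot.mkAlgHom_rel F (OSRel.diag (q := q) (F := F) i)
  · simpa [sOS, h.ne] using RingQuot.mkAlgHom_rel F (OSRel.tri (q := q) (F := F) i j h)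

theorem reflLHS_sOS :
    reflLHS F q (Matrix.of (sOS F q N)) = reflRHS F q (Matrix.of (sOS F q N)) := by
  have h : Matrix.of (sOS F q N) = (Sfree F N).map (RingQuot.mkAlgHom F (OSRel F q N)) := rfl
  rw [h, ← reflLHS_map, ← reflRHS_map]
  ext p r
  exact RingQuot.mkAlgHom_rel F (.refl p r)

variable (F q N) in
/-- The homomorphism `𝒮 → U_q(gl_N)` sending `s_ij` to the `(i,j)` entry of `T T̄ᵗ`. -/
def osHom : AlgOS F q N →ₐ[F] UqGl F q N :=
  RingQuot.liftAlgHom F ⟨FreeAlgebra.lift F fun p => sE F q N p.1 p.2, by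
    have hS : (Sfree F N).map (FreeAlgebra.lift F fun p => sE F q N p.1 p.2)
        = Matrix.of (tE F q N) * (Matrix.of (tbE F q N)).transpose := by
      ext i j; simp [Sfree, sE_eq_mul_transpose]
    intro x y hxy
    cases hxy with
    | tri i j h => simp [sE_of_le h.le, h.ne]
    | diag i => simp [sE_of_le]
    | refl p r =>
      rw [map_reflLHS_apply, map_reflRHS_apply, hS,
        reflLHS_mul_transpose isRTT_tE.rtt isRTT_tE.rtbtb isRTT_tE.rtbt]⟩

theorem osHom_sOS (i j : Fin N) : osHom F q N (sOS F q N i j) = sE F q N i j := by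
  simp [osHom, sOS]

theorem osHom_range : (osHom F q N).range = UtwO F q N := by
  have h : (osHom F q N).comp (RingQuot.mkAlgHom F (OSRel F q N))
      = FreeAlgebra.lift F fun p : Fin N × Fin N => sE F q N p.1 p.2 := by
    ext p
    simpa [sOS] using osHom_sOS (q := q) p.1 p.2
  have h' := AlgHom.range_comp (RingQuot.mkAlgHom F (OSRel F q N)) (osHom F q N)
  rw [(AlgHom.range_eq_top _).2 (RingQuot.mkAlgHom_surjective F _), Algebra.map_top] at h'
  rw [← h', h, UtwO, ← Algebra.adjoin_range_eq_range_freeAlgebra_lift]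
  congr 1
  ext x
  simp [eq_comm]

end Hom

/-! ### The vector representation of `U_q(gl_N)` -/

section Vector

variable {F : Type} [Field F] {q : F} {N : ℕ}

theorem sum_Rc_mul' (i j : Fin N) (f : Fin N → Fin N → F) :
    ∑ k, ∑ l, Rc F q N (i, j) (k, l) * f k l
      = (if i = j then q else 1 : F) * f i j + (if i < j then (q - q⁻¹) * f j i else 0) := by
  have := sum_Rc_mul (A := F) (q := q) i j fun p => f p.1 p.2
  rwa [Fintype.sum_prod_type] at this

theorem Rtil_apply (i j k l : Fin N) : Rtil F q N (i, j) (k, l) =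
    (if i = k ∧ j = l then (if i = j then q⁻¹ else 1) else 0)
      + (if i = l ∧ j = k ∧ j < i then q⁻¹ - q else 0) := by
  simp [Rtil, Prod.ext_iff]

theorem sum_Rtil_smul {M : Type} [AddCommGroup M] [Module F M] (i j : Fin N)
    (f : Fin N → Fin N → M) :
    ∑ k, ∑ l, Rtil F q N (i, j) (k, l) • f k l
      = (if i = j then q⁻¹ else 1 : F) • f i j + (if j < i then (q⁻¹ - q) • f j i else 0) := by
  simp only [Rtil_apply, add_smul, Finset.sum_add_distrib]
  congr 1
  · simp [ite_and, ite_smul]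
  · by_cases h : j < i
    · rw [Finset.sum_comm]
      simp [h, ite_and, ite_smul]
    · simp [h]

theorem sum_Rtil_mul (i j : Fin N) (f : Fin N → Fin N → F) :
    ∑ k, ∑ l, Rtil F q N (i, j) (k, l) * f k l
      = (if i = j then q⁻¹ else 1 : F) * f i j + (if j < i then (q⁻¹ - q) * f j i else 0) := by
  simpa only [smul_eq_mul] using sum_Rtil_smul (q := q) i j f

/-- The matrix over `End F^N` whose `(i,a)` entry is the `(i,a)` block of `M`. -/
def blocks (M : Matrix (Fin N × Fin N) (Fin N × Fin N) F) :
    Matrix (Fin N) (Fin N) (Matrix (Fin N) (Fin N) F) :=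
  Matrix.of fun i a => Matrix.of fun c e => M (i, c) (a, e)

theorem rttLHS_blocks (M M' : Matrix (Fin N × Fin N) (Fin N × Fin N) F)
    (h : ∀ (φ : Fin N → Fin N → Fin N → F) (i j c : Fin N),
      ∑ k, ∑ l, Rc F q N (i, j) (k, l) * ∑ a, ∑ d, M (k, c) (a, d) *
          ∑ b, ∑ e, M' (l, d) (b, e) * φ a b e
        = ∑ b, ∑ d, M' (j, c) (b, d) * ∑ a, ∑ e, M (i, d) (a, e) *
          ∑ k, ∑ l, Rc F q N (a, b) (k, l) * φ k l e) :
    rttLHS F q (blocks M) (blocks M') = rttRHS F q (blocks M) (blocks M') := by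
  ext ⟨i, j⟩ ⟨a, b⟩ c e
  have := h (fun a' b' e' => if a' = a ∧ b' = b ∧ e' = e then 1 else 0) i j c
  simp only [ite_and, mul_ite, mul_one, mul_zero, Finset.sum_ite_eq', Finset.mem_univ, if_true,
    Finset.sum_ite_irrel, Finset.sum_const_zero] at this
  rw [rttLHS_apply, rttRHS_apply, Fintype.sum_prod_type, Fintype.sum_prod_type]
  simp only [Matrix.sum_apply, ← Algebra.smul_def, ← Algebra.commutes (Rc F q N _ _),
    Matrix.smul_apply, smul_eq_mul, blocks, Matrix.mul_apply, Matrix.of_apply]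
  refine this.trans ?_
  simp only [Finset.mul_sum]
  refine (Finset.sum_congr rfl fun b _ => Finset.sum_comm).trans (Finset.sum_comm.trans ?_)
  refine Finset.sum_congr rfl fun a _ => Finset.sum_congr rfl fun b _ =>
    Finset.sum_congr rfl fun d _ => ?_
  ring

theorem blocks_Rtil_self (i : Fin N) :
    blocks (Rtil F q N) i i = Matrix.diagonal fun c => if i = c then q⁻¹ else 1 := by
  ext c e
  simp only [blocks, Matrix.of_apply, Rtil_apply, Matrix.diagonal_apply]
  grind

theorem blocks_Rc_self (i : Fin N) :
    blocks (Rc F q N) i i = Matrix.diagonal fun c => if i = c then q else 1 := by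
  ext c e
  simp only [blocks, Matrix.of_apply, Rc_apply, Matrix.diagonal_apply]
  grind

theorem isRTT_blocks (hq : q ≠ 0) : IsRTT q (blocks (Rtil F q N)) (blocks (Rc F q N)) where
  t_zero i j h := by
    ext c e
    simp only [blocks, Matrix.of_apply, Rtil_apply, Matrix.zero_apply]
    grind
  tb_zero i j h := by
    ext c e
    simp only [blocks, Matrix.of_apply, Rc_apply, Matrix.zero_apply]
    grind
  t_tb i := by
    rw [blocks_Rtil_self, blocks_Rc_self, Matrix.diagonal_mul_diagonal, ← Matrix.diagonal_one]
    congr with c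
    split_ifs <;> simp [hq]
  tb_t i := by
    rw [blocks_Rtil_self, blocks_Rc_self, Matrix.diagonal_mul_diagonal, ← Matrix.diagonal_one]
    congr with c
    split_ifs <;> simp [hq]
  rtt := rttLHS_blocks _ _ fun φ i j c => by
    simp only [sum_Rc_mul', sum_Rtil_mul]
    rcases lt_trichotomy i j with h | h | h <;> rcases lt_trichotomy j c with h' | h' | h' <;>
      rcases lt_trichotomy i c with h'' | h'' | h'' <;> try omega
    all_goals try subst h
    all_goals try subst h'
    all_goals try subst h''
    all_goals simp_all only [lt_self_iff_false, if_true, if_false, ne_of_lt, ne_of_gt,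
      not_lt_of_gt]
    all_goals try field_simp
    all_goals try ring
  rtbtb := rttLHS_blocks _ _ fun φ i j c => by
    simp only [sum_Rc_mul']
    rcases lt_trichotomy i j with h | h | h <;> rcases lt_trichotomy j c with h' | h' | h' <;>
      rcases lt_trichotomy i c with h'' | h'' | h'' <;> try omega
    all_goals try subst h
    all_goals try subst h'
    all_goals try subst h''
    all_goals simp_all only [lt_self_iff_false, if_true, if_false, ne_of_lt, ne_of_gt,
      not_lt_of_gt]
    all_goals try field_simp
    all_goals try ring
  rtbt := rttLHS_blocks _ _ fun φ i j c => by
    simp only [sum_Rc_mul', sum_Rtil_mul]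
    rcases lt_trichotomy i j with h | h | h <;> rcases lt_trichotomy j c with h' | h' | h' <;>
      rcases lt_trichotomy i c with h'' | h'' | h'' <;> try omega
    all_goals try subst h
    all_goals try subst h'
    all_goals try subst h''
    all_goals simp_all only [lt_self_iff_false, if_true, if_false, ne_of_lt, ne_of_gt,
      not_lt_of_gt]
    all_goals try field_simp
    all_goals try ring

end Vector

/-! ### The coproduct with values in the vector representation -/

section Coproduct

variable {F : Type} [Field F] {q : F} {N : ℕ}

theorem isRTT_one : IsRTT q (1 : Matrix (Fin N) (Fin N) F) 1 := by
  have h₁ : amp1 (1 : Matrix (Fin N) (Fin N) F) = 1 := by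
    ext p r; simp [amp1, Matrix.one_apply, Prod.ext_iff]; grind
  have h₂ : amp2 (1 : Matrix (Fin N) (Fin N) F) = 1 := by
    ext p r; simp [amp2, Matrix.one_apply, Prod.ext_iff]; grind
  constructor
  · intro i j h; exact Matrix.one_apply_ne h.ne
  · intro i j h; exact Matrix.one_apply_ne h.ne'
  · simp
  · simp
  all_goals simp [rttLHS, rttRHS, h₁, h₂]

variable (F q N) in
/-- The counit of `U_q(gl_N)`. -/
def counit : UqGl F q N →ₐ[F] F := isRTT_one.lift

/-- The pair of matrices defining the coproduct with values in `End F^N ⊗ U_q(gl_N)`. -/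
theorem isRTT_coprod (hq : q ≠ 0) :
    IsRTT q
      ((blocks (Rtil F q N)).map (Algebra.ofId F (UqGl F q N)).mapMatrix
        * (Matrix.of (tE F q N)).map (Matrix.scalarAlgHom (Fin N) F))
      ((blocks (Rc F q N)).map (Algebra.ofId F (UqGl F q N)).mapMatrix
        * (Matrix.of (tbE F q N)).map (Matrix.scalarAlgHom (Fin N) F)) := by
  have h (M : Matrix (Fin N) (Fin N) F) (x : UqGl F q N) :
      Commute ((Algebra.ofId F (UqGl F q N)).mapMatrix M) (Matrix.scalarAlgHom (Fin N) F x) := by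
    ext a b
    simp [Matrix.scalarAlgHom, Algebra.ofId_apply, Algebra.commutes]
  refine ((isRTT_blocks hq).map _).mul (isRTT_tE.map _) ?_ ?_ ?_ ?_ <;>
  · intro i j k l
    exact h _ _

/-- The coproduct of `U_q(gl_N)` composed with the vector representation in the first factor. -/
def coprod (hq : q ≠ 0) : UqGl F q N →ₐ[F] Matrix (Fin N) (Fin N) (UqGl F q N) :=
  (isRTT_coprod hq).lift

theorem coprod_sE (hq : q ≠ 0) (i j c e : Fin N) :
    coprod hq (sE F q N i j) c e
      = ∑ k, ∑ d, Rtil F q N (i, c) (k, d) • ∑ l, Rc F q N (j, d) (l, e) • sE F q N k l := by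
  have h : coprod hq (sE F q N i j) = ∑ k, ∑ l,
      (Algebra.ofId F (UqGl F q N)).mapMatrix (blocks (Rtil F q N) i k * blocks (Rc F q N) j l)
        * Matrix.scalarAlgHom (Fin N) F (sE F q N k l) := by
    have hc (M : Matrix (Fin N) (Fin N) F) (x : UqGl F q N) :
        (Algebra.ofId F (UqGl F q N)).mapMatrix M * (Matrix.scalarAlgHom (Fin N) F x)
          = (Matrix.scalarAlgHom (Fin N) F x) * (Algebra.ofId F (UqGl F q N)).mapMatrix M := by
      ext a b
      simp [Matrix.scalarAlgHom, Algebra.ofId_apply, Algebra.commutes]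
    rw [coprod, IsRTT.lift_sE, Matrix.mul_apply]
    simp only [Matrix.mul_apply (n := Fin N) (M := Matrix.map _ _), Matrix.transpose_apply,
      Matrix.map_apply, Matrix.of_apply, sE, map_sum, map_mul, Finset.mul_sum]
    rw [Finset.sum_comm]
    refine (Finset.sum_congr rfl fun l _ => Finset.sum_congr rfl fun a _ => Finset.sum_mul _ _ _).trans ?_
    rw [Finset.sum_congr rfl fun l _ => Finset.sum_comm, Finset.sum_comm]
    refine Finset.sum_congr rfl fun k _ => Finset.sum_congr rfl fun l _ =>
      Finset.sum_congr rfl fun a _ => ?_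
    rw [mul_assoc, ← mul_assoc (Matrix.scalarAlgHom (Fin N) F _), ← hc]
    simp only [mul_assoc]
  rw [h, Matrix.sum_apply]
  simp only [Matrix.sum_apply]
  refine Finset.sum_congr rfl fun k _ => ?_
  simp only [Finset.smul_sum, smul_smul]
  rw [Finset.sum_comm]
  refine Finset.sum_congr rfl fun l _ => ?_
  simp [Matrix.scalarAlgHom, Algebra.ofId_apply, ← Finset.sum_smul, blocks, Matrix.mul_apply,
    Matrix.diagonal_apply]
  simp [Algebra.smul_def]

theorem sum_Rc_smul {M : Type} [AddCommGroup M] [Module F M] (j d e : Fin N) (f : Fin N → M) :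
    ∑ l, Rc F q N (j, d) (l, e) • f l
      = (if d = e then (if j = d then q else 1 : F) • f j else 0)
        + if j = e ∧ j < d then (q - q⁻¹) • f d else 0 := by
  simp only [Rc_apply, add_smul, Finset.sum_add_distrib]
  congr 1
  · by_cases hd : d = e <;> simp [hd, ite_smul]
  · by_cases hd : j = e ∧ j < d
    · obtain ⟨rfl, hd⟩ := hd
      simp [hd, ite_smul]
    · rw [if_neg hd]
      refine Finset.sum_eq_zero fun l _ => ?_
      rw [if_neg (by tauto), zero_smul]

theorem sum_Rtil_smul_sum_Rc_smul {M : Type} [AddCommGroup M] [Module F M] (i j c e : Fin N)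
    (f : Fin N → Fin N → M) :
    ∑ k, ∑ d, Rtil F q N (i, c) (k, d) • ∑ l, Rc F q N (j, d) (l, e) • f k l
      = (if i = c then q⁻¹ else 1 : F) •
          ((if c = e then (if j = c then q else 1 : F) • f i j else 0)
            + if j = e ∧ j < c then (q - q⁻¹) • f i c else 0)
        - if c < i then (q - q⁻¹) •
          ((if i = e then (if j = i then q else 1 : F) • f c j else 0)
            + if j = e ∧ j < i then (q - q⁻¹) • f c i else 0) else 0 := by
  simp only [sum_Rc_smul, sum_Rtil_smul]
  refine (congrArg _ ?_).trans (sub_eq_add_neg _ _).symm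
  by_cases h : c < i
  · rw [if_pos h, if_pos h, ← neg_smul, neg_sub]
  · rw [if_neg h, if_neg h, neg_zero]

end Coproduct

/-! ### Lattices spanned by words -/

section Words

variable {F : Type} [Field F] {Γ : Type} [LinearOrderedCommGroupWithZero Γ] {v : Valuation F Γ}
  {A : Type} [Ring A] [Algebra F A] {P : Type} {σ : P → A}

/-- The product of the elements `σ p` along a list. -/
def word (σ : P → A) (l : List P) : A := (l.map σ).prod

variable (v σ) in
/-- The lattice spanned over the valuation ring by the words of length less than `n`. -/
def wordSpan (n : ℕ) : Submodule v.valuationSubring A :=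
  Submodule.span _ (word σ '' {l | l.length < n})

variable (v σ) in
/-- The lattice spanned by the words of length less than `n`, multiplied by the maximal ideal. -/
def smallSpan (n : ℕ) : Submodule v.valuationSubring A :=
  IsLocalRing.maximalIdeal v.valuationSubring • wordSpan v σ n

@[simp] theorem word_nil : word σ [] = 1 := rfl

theorem word_cons (p : P) (l : List P) : word σ (p :: l) = σ p * word σ l := by
  simp [word]

theorem word_append (l l' : List P) : word σ (l ++ l') = word σ l * word σ l' := by
  simp [word]

theorem word_mem {l : List P} {n : ℕ} (h : l.length < n) : word σ l ∈ wordSpan v σ n :=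
  Submodule.subset_span ⟨l, h, rfl⟩

theorem wordSpan_mono {m n : ℕ} (h : m ≤ n) : wordSpan v σ m ≤ wordSpan v σ n :=
  Submodule.span_mono (Set.image_mono fun _ hl => lt_of_lt_of_le hl h)

theorem smallSpan_mono {m n : ℕ} (h : m ≤ n) : smallSpan v σ m ≤ smallSpan v σ n :=
  Submodule.smul_mono le_rfl (wordSpan_mono h)

theorem smallSpan_le (n : ℕ) : smallSpan v σ n ≤ wordSpan v σ n :=
  Submodule.smul_le_right

theorem smul_mem_of_le_one {S : Submodule v.valuationSubring A} {a : F} (ha : v a ≤ 1) {x : A}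
    (hx : x ∈ S) : a • x ∈ S :=
  S.smul_mem (⟨a, ha⟩ : v.valuationSubring) hx

theorem smul_mem_smallSpan {a : F} (ha : v a < 1) {n : ℕ} {x : A} (hx : x ∈ wordSpan v σ n) :
    a • x ∈ smallSpan v σ n :=
  Submodule.smul_mem_smul (r := (⟨a, ha.le⟩ : v.valuationSubring))
    ((v.mem_maximalIdeal_iff).2 ha) hx

theorem smallSpan_induction {n : ℕ} {p : A → Prop} {x : A} (hx : x ∈ smallSpan v σ n)
    (hs : ∀ a : F, v a < 1 → ∀ y ∈ wordSpan v σ n, p (a • y))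
    (ha : ∀ x y, p x → p y → p (x + y)) : p x :=
  Submodule.smul_induction_on hx
    (fun a h y hy => hs a ((v.mem_maximalIdeal_iff).1 h) y hy) ha

theorem mul_mem_wordSpan {a b n : ℕ} (h : ∀ i j, i < a → j < b → i + j < n) {x y : A}
    (hx : x ∈ wordSpan v σ a) (hy : y ∈ wordSpan v σ b) : x * y ∈ wordSpan v σ n := by
  have := Submodule.mul_mem_mul hx hy
  rw [wordSpan, wordSpan, Submodule.span_mul_span] at this
  refine Submodule.span_mono ?_ this
  rintro _ ⟨_, ⟨l, hl, rfl⟩, _, ⟨l', hl', rfl⟩, rfl⟩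
  exact ⟨l ++ l', by simpa using h _ _ hl hl', word_append _ _⟩

theorem mul_mem_smallSpan_left {a b n : ℕ} (h : ∀ i j, i < a → j < b → i + j < n) {x y : A}
    (hx : x ∈ smallSpan v σ a) (hy : y ∈ wordSpan v σ b) : x * y ∈ smallSpan v σ n := by
  refine smallSpan_induction (p := (· * y ∈ smallSpan v σ n)) hx (fun c hc z hz => ?_) fun x x' hx hx' => ?_
  · rw [smul_mul_assoc c]
    exact smul_mem_smallSpan hc (mul_mem_wordSpan h hz hy)
  · rw [add_mul]
    exact add_mem hx hx'

theorem mul_mem_smallSpan_right {a b n : ℕ} (h : ∀ i j, i < a → j < b → i + j < n) {x y : A}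
    (hx : x ∈ wordSpan v σ a) (hy : y ∈ smallSpan v σ b) : x * y ∈ smallSpan v σ n := by
  refine smallSpan_induction (p := (x * · ∈ smallSpan v σ n)) hy (fun c hc z hz => ?_) fun x x' hx hx' => ?_
  · rw [mul_smul_comm c]
    exact smul_mem_smallSpan hc (mul_mem_wordSpan h hx hz)
  · rw [mul_add]
    exact add_mem hx hx'

theorem mul_mem_sup_left {a a' b n n' : ℕ} (h : ∀ i j, i < a → j < b → i + j < n)
    (h' : ∀ i j, i < a' → j < b → i + j < n') {x y : A}
    (hx : x ∈ wordSpan v σ a ⊔ smallSpan v σ a') (hy : y ∈ wordSpan v σ b) :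
    x * y ∈ wordSpan v σ n ⊔ smallSpan v σ n' := by
  obtain ⟨x₁, h₁, x₂, h₂, rfl⟩ := Submodule.mem_sup.1 hx
  rw [add_mul]
  exact Submodule.add_mem_sup (mul_mem_wordSpan h h₁ hy) (mul_mem_smallSpan_left h' h₂ hy)

theorem mul_mem_sup_right {a b b' n n' : ℕ} (h : ∀ i j, i < a → j < b → i + j < n)
    (h' : ∀ i j, i < a → j < b' → i + j < n') {x y : A}
    (hx : x ∈ wordSpan v σ a) (hy : y ∈ wordSpan v σ b ⊔ smallSpan v σ b') :
    x * y ∈ wordSpan v σ n ⊔ smallSpan v σ n' := by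
  obtain ⟨y₁, h₁, y₂, h₂, rfl⟩ := Submodule.mem_sup.1 hy
  rw [mul_add]
  exact Submodule.add_mem_sup (mul_mem_wordSpan h hx h₁) (mul_mem_smallSpan_right h' hx h₂)

theorem gen_mem (p : P) : σ p ∈ wordSpan v σ 2 := by
  simpa [word_cons] using word_mem (v := v) (σ := σ) (l := [p]) (n := 2) (by simp)

theorem one_mem_wordSpan {n : ℕ} (h : 0 < n) : (1 : A) ∈ wordSpan v σ n :=
  word_mem (l := []) (by simpa using h)

/-! ### Ordered words span, if the generators commute up to smaller terms -/

theorem word_sub_word_mem_of_perm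
    (hσ : ∀ p r, σ p * σ r - σ r * σ p ∈ wordSpan v σ 2 ⊔ smallSpan v σ 3)
    {l l' : List P} (h : l.Perm l') :
    word σ l - word σ l' ∈ wordSpan v σ l.length ⊔ smallSpan v σ (l.length + 1) := by
  induction h with
  | nil => simp
  | cons p h ih =>
    rw [word_cons, word_cons, ← mul_sub]
    exact mul_mem_sup_right (by simp; omega) (by simp; omega) (gen_mem p) ih
  | swap p r l =>
    rw [word_cons, word_cons, word_cons, word_cons, ← mul_assoc, ← mul_assoc, ← sub_mul]
    exact mul_mem_sup_left (by simp; omega) (by simp; omega) (hσ _ _)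
      (word_mem (Nat.lt_succ_self l.length))
  | trans h h' ih ih' =>
    rw [← h.length_eq] at ih'
    simpa using add_mem ih ih'

theorem wordSpan_fg [Finite P] (n : ℕ) : (wordSpan v σ n).FG :=
  Submodule.fg_span ((List.finite_length_lt P n).image _)

theorem wordSpan_le_span_multiset [Finite P]
    (hσ : ∀ p r, σ p * σ r - σ r * σ p ∈ wordSpan v σ 2 ⊔ smallSpan v σ 3) (n : ℕ) :
    wordSpan v σ n ≤ Submodule.span v.valuationSubring
      (Set.range fun α : Multiset P => word σ α.toList) := by
  induction n using Nat.strong_induction_on with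
  | h n ih =>
    refine Submodule.le_of_le_smul_of_le_jacobson_bot (wordSpan_fg n)
      (IsLocalRing.maximalIdeal_le_jacobson _) (Submodule.span_le.2 ?_)
    rintro _ ⟨l, hl, rfl⟩
    have hp : l.Perm (Multiset.toList (l : Multiset P)) := by
      rw [← Multiset.coe_eq_coe, Multiset.coe_toList]
    have h := word_sub_word_mem_of_perm hσ hp
    rw [← sub_add_cancel (word σ l) (word σ (Multiset.toList (l : Multiset P)))]
    refine add_mem (sup_le_sup (ih _ hl) (smallSpan_mono hl) h) ?_
    exact Submodule.mem_sup_left (Submodule.subset_span ⟨_, rfl⟩)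

theorem span_word_multiset_eq_top [Finite P]
    (hσ : ∀ p r, σ p * σ r - σ r * σ p ∈ wordSpan v σ 2 ⊔ smallSpan v σ 3)
    (hgen : Algebra.adjoin F (Set.range σ) = ⊤) :
    Submodule.span F (Set.range fun α : Multiset P => word σ α.toList) = ⊤ := by
  rw [eq_top_iff, ← Algebra.top_toSubmodule, ← hgen, Algebra.adjoin_eq_span, Submodule.span_le]
  intro x hx
  obtain ⟨l, hl, rfl⟩ := Submonoid.exists_list_of_mem_closure hx
  obtain ⟨l, rfl⟩ : l ∈ Set.range (List.map σ) := by
    rwa [Set.range_list_map]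
  exact Submodule.span_le_restrictScalars v.valuationSubring F _
    (wordSpan_le_span_multiset hσ _ (word_mem (Nat.lt_succ_self l.length)))

end Words

/-! ### Linear independence of ordered words, from a coproduct -/

section Independence

/-- The positions below the diagonal. -/
abbrev LowerPos (N : ℕ) : Type := {p : Fin N × Fin N // p.2 < p.1}

variable {F : Type} [Field F] {Γ : Type} [LinearOrderedCommGroupWithZero Γ] {v : Valuation F Γ}
  {A : Type} [Ring A] [Algebra F A] {N : ℕ} {σ : LowerPos N → A}

variable (F) in
/-- The antisymmetric matrix `E_ij - E_ji` attached to the position `(i,j)`. -/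
def skewUnit (p : LowerPos N) (a b : Fin N) : F :=
  (if p.1 = (a, b) then 1 else 0) - (if p.1 = (b, a) then 1 else 0)

variable (F σ) in
/-- The derivation along words with values `E_ij - E_ji` on the generator at position `(i,j)`. -/
def derWord (a b : Fin N) : List (LowerPos N) → A
  | [] => 0
  | p :: l => skewUnit F p a b • word σ l + σ p * derWord a b l

/-- The lists obtained from a list by removing one occurrence of `c`. -/
def removals (c : LowerPos N) : List (LowerPos N) → List (List (LowerPos N))
  | [] => []
  | p :: l => (if p = c then [l] else []) ++ (removals c l).map (p :: ·)

theorem length_removals (c : LowerPos N) (l : List (LowerPos N)) :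
    (removals c l).length = l.count c := by
  induction l with
  | nil => rfl
  | cons p l ih =>
    rw [removals, List.length_append, List.length_map, ih, List.count_cons]
    by_cases h : p = c
    · simp [h, add_comm]
    · rw [if_neg h, if_neg (mt eq_of_beq h)]
      simp

theorem perm_of_mem_removals {c : LowerPos N} {l r : List (LowerPos N)} (h : r ∈ removals c l) :
    (c :: r).Perm l := by
  induction l generalizing r with
  | nil => simp [removals] at h
  | cons p l ih =>
    rw [removals, List.mem_append, List.mem_map] at h
    rcases h with h | ⟨r, hr, rfl⟩
    · by_cases hp : p = c
      · rw [if_pos hp, List.mem_singleton] at h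
        rw [h, hp]
      · simp [hp] at h
    · exact (List.Perm.swap _ _ _).trans ((ih hr).cons p)

theorem derWord_eq_sum_removals (c : LowerPos N) (l : List (LowerPos N)) :
    derWord F σ c.1.1 c.1.2 l = ((removals c l).map (word σ)).sum := by
  induction l with
  | nil => rfl
  | cons p l ih =>
    have h : skewUnit F p c.1.1 c.1.2 = if p = c then 1 else 0 := by
      have h₁ : p.1 ≠ (c.1.2, c.1.1) := fun h => by
        have h₂ := p.2
        rw [h] at h₂
        exact lt_asymm h₂ c.2
      rw [skewUnit, if_neg h₁, sub_zero]
      simp [Subtype.ext_iff]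
    rw [derWord, removals, ih, h, List.map_append, List.sum_append]
    congr 1
    · by_cases hp : p = c <;> simp [hp]
    · rw [← List.sum_map_mul_left, List.map_map]
      simp [Function.comp_def, word_cons]

theorem v_skewUnit_le (p : LowerPos N) (a b : Fin N) : v (skewUnit F p a b) ≤ 1 := by
  refine (v.map_sub _ _).trans (max_le ?_ ?_) <;> split_ifs <;> simp

theorem derWord_mem (a b : Fin N) (l : List (LowerPos N)) :
    derWord F σ a b l ∈ wordSpan v σ l.length := by
  induction l with
  | nil => exact zero_mem _
  | cons p l ih =>
    exact add_mem (smul_mem_of_le_one (v_skewUnit_le p a b) (word_mem (Nat.lt_succ_self _)))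
      (mul_mem_wordSpan (by simp; omega) (gen_mem p) ih)

variable {Δ : A →ₐ[F] Matrix (Fin N) (Fin N) A} {ε : A →ₐ[F] F}

theorem coprod_word_sub_mem
    (hΔ : ∀ p a b, Δ (σ p) a b - (if a = b then σ p else 0) - algebraMap F A (skewUnit F p a b)
      ∈ smallSpan v σ 2) (l : List (LowerPos N)) (a b : Fin N) :
    Δ (word σ l) a b - (if a = b then word σ l else 0) - derWord F σ a b l
      ∈ wordSpan v σ (l.length - 1) ⊔ smallSpan v σ (l.length + 1) := by
  induction l generalizing a b with
  | nil => simp [derWord, Matrix.one_apply]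
  | cons p l ih =>
    have hw (e b : Fin N) : Δ (word σ l) e b ∈ wordSpan v σ (l.length + 1) := by
      have h₁ : (wordSpan v σ (l.length - 1) ⊔ smallSpan v σ (l.length + 1)) ≤
          wordSpan v σ (l.length + 1) := sup_le (wordSpan_mono (by omega)) (smallSpan_le _)
      have h₂ := wordSpan_mono (Nat.le_succ _) (derWord_mem (F := F) (σ := σ) (v := v) e b l)
      have h₃ : (if e = b then word σ l else 0) ∈ wordSpan v σ (l.length + 1) := by
        split_ifs
        · exact word_mem (Nat.lt_succ_self _)
        · exact zero_mem _
      have := add_mem (add_mem (h₁ (ih e b)) h₂) h₃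
      rwa [sub_add_cancel, sub_add_cancel] at this
    have key : Δ (word σ (p :: l)) a b - (if a = b then word σ (p :: l) else 0)
          - derWord F σ a b (p :: l)
        = σ p * (Δ (word σ l) a b - (if a = b then word σ l else 0) - derWord F σ a b l)
          + ∑ e, skewUnit F p a e •
            (derWord F σ e b l + (Δ (word σ l) e b - (if e = b then word σ l else 0)
              - derWord F σ e b l))
          + ∑ e, (Δ (σ p) a e - (if a = e then σ p else 0) - algebraMap F A (skewUnit F p a e))
            * Δ (word σ l) e b := by
      rw [word_cons, map_mul, Matrix.mul_apply, derWord]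
      simp only [sub_mul, Finset.sum_sub_distrib, smul_add, smul_sub, Finset.sum_add_distrib,
        ite_mul, zero_mul, Finset.sum_ite_eq, Finset.mem_univ, if_true, ← Algebra.smul_def,
        mul_sub, mul_ite, mul_zero, smul_ite, smul_zero, Finset.sum_ite_eq']
      abel
    rw [key, List.length_cons, Nat.add_sub_cancel]
    refine add_mem (add_mem ?_ (sum_mem fun e _ => ?_)) (sum_mem fun e _ => ?_)
    · exact mul_mem_sup_right (by omega) (by omega) (gen_mem p) (ih a b)
    · refine smul_mem_of_le_one (v_skewUnit_le _ _ _) (add_mem ?_ ?_)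
      · exact Submodule.mem_sup_left (derWord_mem _ _ _)
      · exact sup_le_sup (wordSpan_mono (by omega)) (smallSpan_mono (by omega)) (ih e b)
    · exact Submodule.mem_sup_right (mul_mem_smallSpan_left (by omega) (hΔ p a e) (hw e b))

variable (Δ ε) in
/-- The functional attached to a list of positions: iterated coproduct entries and the counit. -/
def wordFun : List (LowerPos N) → A →ₗ[F] F
  | [] => ε.toLinearMap
  | c :: x => wordFun x ∘ₗ Matrix.entryLinearMap F A c.1.1 c.1.2 ∘ₗ Δ.toLinearMap

theorem wordFun_cons (c : LowerPos N) (x : List (LowerPos N)) (a : A) :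
    wordFun Δ ε (c :: x) a = wordFun Δ ε x (Δ a c.1.1 c.1.2) := rfl

theorem v_map_le_of_mem_wordSpan {f : A →ₗ[F] F} {n : ℕ} {u : A} {γ : Γ}
    (hf : ∀ l : List (LowerPos N), l.length < n → v (f (word σ l)) ≤ γ)
    (hu : u ∈ wordSpan v σ n) : v (f u) ≤ γ := by
  refine Submodule.span_induction (p := fun u _ => v (f u) ≤ γ) ?_ (by simp) ?_ ?_ hu
  · rintro _ ⟨l, hl, rfl⟩
    exact hf l hl
  · intro x y _ _ hx hy
    rw [map_add]
    exact v.map_add_le hx hy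
  · intro a x _ hx
    rw [show f (a • x) = (a : F) * f x from f.map_smul (a : F) x, map_mul]
    exact mul_le_of_le_one_of_le a.2 hx

theorem v_map_lt_of_mem_wordSpan {f : A →ₗ[F] F} {n : ℕ} {u : A}
    (hf : ∀ l : List (LowerPos N), l.length < n → v (f (word σ l)) < 1)
    (hu : u ∈ wordSpan v σ n) : v (f u) < 1 := by
  refine Submodule.span_induction (p := fun u _ => v (f u) < 1) ?_ (by simp) ?_ ?_ hu
  · rintro _ ⟨l, hl, rfl⟩
    exact hf l hl
  · intro x y _ _ hx hy
    rw [map_add]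
    exact v.map_add_lt hx hy
  · intro a x _ hx
    rw [show f (a • x) = (a : F) * f x from f.map_smul (a : F) x, map_mul]
    exact (mul_le_of_le_one_left' a.2).trans_lt hx

theorem v_map_lt_of_mem_smallSpan {f : A →ₗ[F] F} {n : ℕ} {u : A}
    (hf : ∀ l : List (LowerPos N), v (f (word σ l)) ≤ 1) (hu : u ∈ smallSpan v σ n) :
    v (f u) < 1 := by
  refine smallSpan_induction (p := fun u => v (f u) < 1) hu ?_ fun x y hx hy => ?_
  · intro a ha y hy
    rw [map_smul, smul_eq_mul, map_mul]
    exact mul_lt_one_of_lt_of_le ha (v_map_le_of_mem_wordSpan (fun l _ => hf l) hy)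
  · rw [map_add]
    exact v.map_add_lt hx hy

theorem v_list_sum_sub_lt {ι : Type} {L : List ι} {g : ι → F} {t : F}
    (h : ∀ l ∈ L, v (g l - t) < 1) : v ((L.map g).sum - L.length * t) < 1 := by
  induction L with
  | nil => simp
  | cons a L ih =>
    have := v.map_add_lt (h a (by simp)) (ih fun l hl => h l (by simp [hl]))
    convert this using 2
    simp
    ring

theorem wordFun_word (hε : ∀ p, ε (σ p) = 0)
    (hΔ : ∀ p a b, Δ (σ p) a b - (if a = b then σ p else 0) - algebraMap F A (skewUnit F p a b)
      ∈ smallSpan v σ 2) (x : List (LowerPos N)) :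
    (∀ l, v (wordFun Δ ε x (word σ l)) ≤ 1) ∧
    (∀ l, l.length < x.length → v (wordFun Δ ε x (word σ l)) < 1) ∧
    ∃ n : ℕ, n ≠ 0 ∧ ∀ l, l.length = x.length →
      v (wordFun Δ ε x (word σ l) - if x.Perm l then (n : F) else 0) < 1 := by
  induction x with
  | nil =>
    refine ⟨fun l => ?_, by simp, 1, one_ne_zero, ?_⟩
    · cases l <;> simp [wordFun, word_cons, hε]
    · intro l hl
      rw [List.length_eq_zero_iff.1 hl]
      simp [wordFun]
  | cons c x ih =>
    obtain ⟨h₁, h₂, n, hn0, h₃⟩ := ih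
    have key (l : List (LowerPos N)) : ∃ r ∈ wordSpan v σ (l.length - 1) ⊔
        smallSpan v σ (l.length + 1), wordFun Δ ε (c :: x) (word σ l)
          = ((removals c l).map fun l' => wordFun Δ ε x (word σ l')).sum + wordFun Δ ε x r := by
      refine ⟨_, coprod_word_sub_mem hΔ l c.1.1 c.1.2, ?_⟩
      rw [if_neg c.2.ne', sub_zero, wordFun_cons, derWord_eq_sum_removals, map_sub, map_list_sum,
        List.map_map]
      simp [Function.comp_def]
    have hr₁ {m m' : ℕ} {r : A} (hr : r ∈ wordSpan v σ m ⊔ smallSpan v σ m') :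
        v (wordFun Δ ε x r) ≤ 1 :=
      v_map_le_of_mem_wordSpan (fun l _ => h₁ l)
        (sup_le (wordSpan_mono (le_max_left m m'))
          ((smallSpan_le _).trans (wordSpan_mono (le_max_right m m'))) hr)
    have hr₂ {m m' : ℕ} {r : A} (hr : r ∈ wordSpan v σ m ⊔ smallSpan v σ m') (hm : m ≤ x.length) :
        v (wordFun Δ ε x r) < 1 := by
      obtain ⟨r₁, hr₁, r₂, hr₂, rfl⟩ := Submodule.mem_sup.1 hr
      rw [map_add]
      exact v.map_add_lt (v_map_lt_of_mem_wordSpan (fun l hl => h₂ l (hl.trans_le hm)) hr₁)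
        (v_map_lt_of_mem_smallSpan h₁ hr₂)
    have hlen {l r : List (LowerPos N)} (h : r ∈ removals c l) : r.length + 1 = l.length := by
      simpa using (perm_of_mem_removals h).length_eq
    refine ⟨fun l => ?_, fun l hl => ?_, (c :: x).count c * n, ?_, fun l hl => ?_⟩
    · obtain ⟨r, hr, h⟩ := key l
      rw [h]
      refine v.map_add_le ?_ (hr₁ hr)
      refine List.sum_induction (fun t => v t ≤ 1) (fun _ _ => v.map_add_le) (by simp) ?_
      simp only [List.mem_map]
      rintro _ ⟨l', _, rfl⟩
      exact h₁ l'
    · obtain ⟨r, hr, h⟩ := key l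
      rw [h]
      rw [List.length_cons] at hl
      refine v.map_add_lt ?_ (hr₂ hr (by omega))
      have := v_list_sum_sub_lt (v := v) (L := removals c l)
        (g := fun l' => wordFun Δ ε x (word σ l')) (t := 0) fun l' hl' => by
          rw [sub_zero]
          exact h₂ l' (by have := hlen hl'; omega)
      simpa using this
    · simp [hn0]
    · obtain ⟨r, hr, h⟩ := key l
      rw [List.length_cons] at hl
      rw [h, add_sub_right_comm]
      refine v.map_add_lt ?_ (hr₂ hr (by omega))
      by_cases hp : (c :: x).Perm l
      · rw [if_pos hp, hp.count_eq, ← length_removals, Nat.cast_mul]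
        refine v_list_sum_sub_lt fun l' hl' => ?_
        have := h₃ l' (by have := hlen hl'; omega)
        rwa [if_pos] at this
        exact (hp.trans (perm_of_mem_removals hl').symm).cons_inv
      · rw [if_neg hp]
        have := v_list_sum_sub_lt (v := v) (L := removals c l)
          (g := fun l' => wordFun Δ ε x (word σ l')) (t := 0) fun l' hl' => by
            have := h₃ l' (by have := hlen hl'; omega)
            rwa [if_neg] at this
            exact fun h => hp ((h.cons c).trans (perm_of_mem_removals hl'))
        simpa using this

/-- Ordered words are linearly independent. -/
theorem linearIndependent_word_multiset (hn : ∀ n : ℕ, n ≠ 0 → v (n : F) = 1)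
    (hε : ∀ p, ε (σ p) = 0)
    (hΔ : ∀ p a b, Δ (σ p) a b - (if a = b then σ p else 0) - algebraMap F A (skewUnit F p a b)
      ∈ smallSpan v σ 2) :
    LinearIndependent F fun α : Multiset (LowerPos N) => word σ α.toList := by
  rw [linearIndependent_iff]
  intro z hz
  by_contra hz0
  obtain ⟨α, hα, hmax⟩ := Finset.exists_max_image z.support
    (fun α => toLex (v (z α), Multiset.card α)) (Finsupp.support_nonempty_iff.2 hz0)
  have hα0 : v (z α) ≠ 0 := (v.ne_zero_iff).2 (Finsupp.mem_support_iff.1 hα)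
  obtain ⟨h₁, h₂, n, hn0, h₃⟩ := wordFun_word hε hΔ α.toList
  have hf := congrArg (wordFun Δ ε α.toList) hz
  rw [Finsupp.linearCombination_apply, Finsupp.sum, map_sum, map_zero,
    ← Finset.add_sum_erase _ _ hα] at hf
  simp only [map_smul, smul_eq_mul] at hf
  have hαv : v (wordFun Δ ε α.toList (word σ α.toList)) = 1 := by
    have h := h₃ α.toList rfl
    rw [if_pos (List.Perm.refl _)] at h
    rw [← hn n hn0]
    rw [← hn n hn0] at h
    exact v.map_eq_of_sub_lt h
  have hlt : v (∑ β ∈ z.support.erase α, z β * wordFun Δ ε α.toList (word σ β.toList))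
      < v (z α) := by
    refine v.map_sum_lt hα0 fun β hβ => ?_
    obtain ⟨hne, hβ⟩ := Finset.mem_erase.1 hβ
    rw [map_mul]
    have hβ0 : 0 < v (z β) := zero_lt_iff.2 ((v.ne_zero_iff).2 (Finsupp.mem_support_iff.1 hβ))
    rcases Prod.Lex.toLex_le_toLex.1 (hmax β hβ) with h | ⟨h, h'⟩
    · exact (mul_le_of_le_one_right' (h₁ _)).trans_lt h
    · have : v (wordFun Δ ε α.toList (word σ β.toList)) < 1 := by
        rcases h'.lt_or_eq with h' | h'
        · exact h₂ _ (by simpa using h')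
        · have := h₃ β.toList (by simpa using h')
          rwa [if_neg, sub_zero] at this
          intro hp
          rw [← Multiset.coe_eq_coe, Multiset.coe_toList, Multiset.coe_toList] at hp
          exact hne hp.symm
      simp only at h
      rw [← h]
      exact mul_lt_of_lt_one_right hβ0 this
  rw [← v.map_neg, ← eq_neg_of_add_eq_zero_left hf, map_mul, hαv, mul_one] at hlt
  exact lt_irrefl _ hlt

end Independence

/-! ### Specialization at `q = 1` -/

section Specialization

variable {F : Type} [Field F] {q : F} {Γ : Type} [LinearOrderedCommGroupWithZero Γ]
  {v : Valuation F Γ} {A : Type} [Ring A] [Algebra F A] {N : ℕ}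

theorem v_eq_one_of_sub_one (hq : v (q - 1) < 1) : v q = 1 := by
  simpa using v.map_one_add_of_lt hq

theorem v_inv_sub_one_lt (hq : v (q - 1) < 1) : v (q⁻¹ - 1) < 1 := by
  have hv := v_eq_one_of_sub_one hq
  have h0 : q ≠ 0 := by
    rintro rfl
    simp at hv
  have h : q⁻¹ - 1 = -((q - 1) * q⁻¹) := by
    field_simp
    ring
  rwa [h, v.map_neg, map_mul, map_inv₀, hv, inv_one, mul_one]

theorem v_sub_inv_lt (hq : v (q - 1) < 1) : v (q - q⁻¹) < 1 := by
  have := v.map_sub_lt hq (v_inv_sub_one_lt hq)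
  rwa [sub_sub_sub_cancel_right] at this

theorem v_inv_sub_inv_mul_sub_one_le (hq : v (q - 1) < 1) (h₂ : v 2 = 1) :
    v ((q - q⁻¹)⁻¹ * (q - 1)) ≤ 1 := by
  have hv := v_eq_one_of_sub_one hq
  have h0 : q ≠ 0 := by
    rintro rfl
    simp at hv
  have h : q - q⁻¹ = (q - 1) * ((2 + (q - 1)) * q⁻¹) := by
    field_simp
    ring
  by_cases h1 : q - 1 = 0
  · simp [h1]
  · have : v (2 + (q - 1)) = 1 := by
      rw [v.map_add_eq_of_lt_left (by rwa [h₂]), h₂]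
    rw [h, map_mul, map_inv₀, map_mul, map_mul, map_inv₀, this, hv]
    simp [h1]

variable (q) in
/-- The rescaled generators `s_ij / (q - q⁻¹)`, `j < i`. -/
def lowerGen (s : Fin N → Fin N → A) (p : LowerPos N) : A := (q - q⁻¹)⁻¹ • s p.1.1 p.1.2

variable {s : Fin N → Fin N → A}

theorem smul_lowerGen (hh : q - q⁻¹ ≠ 0) (p : LowerPos N) :
    (q - q⁻¹) • lowerGen q s p = s p.1.1 p.1.2 :=
  smul_inv_smul₀ hh _

theorem gen_sub_one_mem (hq : v (q - 1) < 1) (hh : q - q⁻¹ ≠ 0)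
    (hs : ∀ i j, i ≤ j → s i j = if i = j then 1 else 0) (i j : Fin N) :
    s i j - (if i = j then 1 else 0) ∈ smallSpan v (lowerGen q s) 2 := by
  rcases le_or_gt i j with h | h
  · rw [hs i j h, sub_self]
    exact zero_mem _
  · rw [if_neg h.ne', sub_zero,
      show s i j = (q - q⁻¹) • lowerGen q s ⟨(i, j), h⟩ from
        (smul_lowerGen hh ⟨(i, j), h⟩).symm]
    exact smul_mem_smallSpan (v_sub_inv_lt hq) (gen_mem _)

theorem coprod_formula_sub_mem (hq : v (q - 1) < 1) (hh : q - q⁻¹ ≠ 0)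
    (hs : ∀ i j, i ≤ j → s i j = if i = j then 1 else 0) (p : LowerPos N) (c e : Fin N) :
    (q - q⁻¹)⁻¹ • (∑ k, ∑ d, Rtil F q N (p.1.1, c) (k, d) •
          ∑ l, Rc F q N (p.1.2, d) (l, e) • s k l)
        - (if c = e then lowerGen q s p else 0) - algebraMap F A (skewUnit F p c e)
      ∈ smallSpan v (lowerGen q s) 2 := by
  obtain ⟨⟨i, j⟩, hij⟩ := p
  simp only at hij
  have hv := v_eq_one_of_sub_one hq
  have hq' := v_inv_sub_one_lt hq
  have hone {a : F} (ha : v (a - 1) < 1) {x : A} {n : ℕ}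
      (hx : x ∈ wordSpan v (lowerGen q s) n) : a • x - x ∈ smallSpan v (lowerGen q s) n := by
    rw [← one_smul F x, smul_smul, mul_one, ← sub_smul]
    exact smul_mem_smallSpan ha hx
  have h₁ : (q - q⁻¹)⁻¹ • ((if i = c then q⁻¹ else 1 : F) •
        if c = e then (if j = c then q else 1 : F) • s i j else 0)
      - (if c = e then lowerGen q s ⟨(i, j), hij⟩ else 0)
      ∈ smallSpan v (lowerGen q s) 2 := by
    by_cases hce : c = e
    · rw [if_pos hce, if_pos hce, smul_comm (q - q⁻¹)⁻¹, smul_comm (q - q⁻¹)⁻¹,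
        show (q - q⁻¹)⁻¹ • s i j = lowerGen q s ⟨(i, j), hij⟩ from rfl, smul_smul]
      refine hone ?_ (gen_mem _)
      by_cases hic : i = c
      · subst hic
        simpa [hij.ne] using hq'
      · by_cases hjc : j = c <;> simp [hic, hjc, hq]
    · simp [hce]
  have h₂ : (q - q⁻¹)⁻¹ • ((if i = c then q⁻¹ else 1 : F) •
        if j = e ∧ j < c then (q - q⁻¹) • s i c else 0) - (if i = c ∧ j = e then 1 else 0)
      ∈ smallSpan v (lowerGen q s) 2 := by
    by_cases hje : j = e ∧ j < c
    · rw [if_pos hje, smul_comm, inv_smul_smul₀ hh]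
      by_cases hic : i = c
      · rw [if_pos hic, if_pos ⟨hic, hje.1⟩, hs i c hic.le, if_pos hic]
        exact hone hq' (one_mem_wordSpan two_pos)
      · simpa [hic] using gen_sub_one_mem hq hh hs i c
    · have : ¬ (i = c ∧ j = e) := fun h => hje ⟨h.2, h.1 ▸ hij⟩
      rw [if_neg hje, if_neg this]
      simp
  have h₃ : (q - q⁻¹)⁻¹ • (if c < i then (q - q⁻¹) •
          ((if i = e then (if j = i then q else 1 : F) • s c j else 0)
            + if j = e ∧ j < i then (q - q⁻¹) • s c i else 0) else 0)
        - (if i = e ∧ j = c then 1 else 0) ∈ smallSpan v (lowerGen q s) 2 := by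
    by_cases hc : c < i
    · rw [if_pos hc, inv_smul_smul₀ hh, hs c i hc.le, if_neg hc.ne, smul_zero, ite_self, add_zero,
        if_neg hij.ne, one_smul]
      by_cases hie : i = e
      · simpa [hie, eq_comm] using gen_sub_one_mem hq hh hs c j
      · simp [hie]
    · have : ¬ (i = e ∧ j = c) := fun h => hc (h.2 ▸ hij)
      rw [if_neg hc, if_neg this]
      simp
  have hsk : algebraMap F A (skewUnit F ⟨(i, j), hij⟩ c e)
      = (if i = c ∧ j = e then 1 else 0) - (if i = e ∧ j = c then 1 else 0) := by
    rw [skewUnit, map_sub]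
    congr 1 <;> simp only [Prod.mk.injEq] <;> split_ifs <;> simp
  rw [sum_Rtil_smul_sum_Rc_smul, hsk]
  convert sub_mem (add_mem h₁ h₂) h₃ using 1
  rw [smul_add, smul_sub, smul_add]
  abel

/-! ### Generators satisfying the reflection equation commute up to smaller terms -/

theorem commutator_eq_of_reflection {B : Type} [Ring B] [Algebra F B] {h : F} (hh : h ≠ 0)
    {r r' a b : B}
    (H : (1 + h • r) * (1 + h • a) * (1 + h • r') * (1 + h • b)
      = (1 + h • b) * (1 + h • r') * (1 + h • a) * (1 + h • r)) :
    a * b - b * a = (b * r' + b * r + r' * a + a * r - r * a - r * b - a * r' - r' * b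
          + (r' * r - r * r'))
        + h • (b * (r' * a) + b * (r' * r) + b * (a * r) + r' * (a * r)
          - r * (a * r') - r * (a * b) - r * (r' * b) - a * (r' * b)
          + h • (b * (r' * (a * r)) - r * (a * (r' * b)))) := by
  refine smul_right_injective B (pow_ne_zero 2 hh) ?_
  simp only [add_mul, mul_add, one_mul, mul_one, smul_mul_assoc, mul_smul_comm, mul_assoc] at H ⊢
  rw [← sub_eq_zero] at H ⊢
  rw [← H]
  module

theorem v_Rc_sub_one_le (hq : v (q - 1) < 1) (hh : q - q⁻¹ ≠ 0) (h₂ : v 2 = 1)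
    (i j k l : Fin N) : v (((q - q⁻¹)⁻¹ • (Rc F q N - 1)) (i, j) (k, l)) ≤ 1 := by
  have : ((q - q⁻¹)⁻¹ • (Rc F q N - 1)) (i, j) (k, l)
      = (if i = k ∧ j = l ∧ i = j then (q - q⁻¹)⁻¹ * (q - 1) else 0)
        + (if i = l ∧ j = k ∧ i < j then 1 else 0) := by
    simp only [Matrix.smul_apply, Matrix.sub_apply, Rc_apply, Matrix.one_apply, Prod.mk.injEq,
      smul_eq_mul]
    rw [add_sub_right_comm, mul_add]
    congr 1
    · by_cases h : i = k ∧ j = l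
      · obtain ⟨rfl, rfl⟩ := h
        by_cases hij : i = j <;> simp [hij]
      · rw [if_neg h, if_neg h, if_neg (by tauto), sub_zero, mul_zero]
    · split_ifs <;> simp [hh]
  rw [this]
  refine v.map_add_le ?_ ?_
  · split_ifs
    · exact v_inv_sub_inv_mul_sub_one_le hq h₂
    · simp
  · split_ifs <;> simp

theorem v_Rct_sub_one_le (hq : v (q - 1) < 1) (hh : q - q⁻¹ ≠ 0) (h₂ : v 2 = 1)
    (i j k l : Fin N) : v (((q - q⁻¹)⁻¹ • (Rct F q N - 1)) (i, j) (k, l)) ≤ 1 := by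
  have : ((q - q⁻¹)⁻¹ • (Rct F q N - 1)) (i, j) (k, l)
      = ((q - q⁻¹)⁻¹ • (Rc F q N - 1)) (k, j) (i, l) := by
    simp [Rct_apply, Matrix.one_apply, eq_comm]
  rw [this]
  exact v_Rc_sub_one_le hq hh h₂ _ _ _ _

section MatrixLattice

variable {P : Type} {σ : P → A}

theorem liftF_mem_matrix_wordSpan {m : Type} {M : Matrix m m F} (hM : ∀ i j, v (M i j) ≤ 1)
    {n : ℕ} (hn : 0 < n) : (liftF F M : Matrix m m A) ∈ (wordSpan v σ n).matrix := fun i j => by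
  rw [liftF, Matrix.map_apply, Algebra.algebraMap_eq_smul_one]
  exact smul_mem_of_le_one (hM i j) (one_mem_wordSpan hn)

theorem mul_mem_matrix_wordSpan {m : Type} [Fintype m] {X Y : Matrix m m A} {a b n : ℕ}
    (h : ∀ i j, i < a → j < b → i + j < n) (hX : X ∈ (wordSpan v σ a).matrix)
    (hY : Y ∈ (wordSpan v σ b).matrix) : X * Y ∈ (wordSpan v σ n).matrix := fun i j => by
  rw [Matrix.mul_apply]
  exact sum_mem fun k _ => mul_mem_wordSpan h (hX i k) (hY k j)

section

variable {m : Type} [Fintype m] {ρ ρ' a b : Matrix m m A}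

theorem linear_mem_matrix_wordSpan
    (hρ : ρ ∈ (wordSpan v σ 1).matrix) (hρ' : ρ' ∈ (wordSpan v σ 1).matrix)
    (ha : a ∈ (wordSpan v σ 2).matrix) (hb : b ∈ (wordSpan v σ 2).matrix) :
    b * ρ' + b * ρ + ρ' * a + a * ρ - ρ * a - ρ * b - a * ρ' - ρ' * b + (ρ' * ρ - ρ * ρ')
      ∈ (wordSpan v σ 2).matrix := by
  have m₀ {X Y : Matrix m m A} (hX : X ∈ (wordSpan v σ 1).matrix)
      (hY : Y ∈ (wordSpan v σ 1).matrix) : X * Y ∈ (wordSpan v σ 2).matrix :=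
    mul_mem_matrix_wordSpan (by omega) hX hY
  have m₁ {X Y : Matrix m m A} (hX : X ∈ (wordSpan v σ 1).matrix)
      (hY : Y ∈ (wordSpan v σ 2).matrix) : X * Y ∈ (wordSpan v σ 2).matrix :=
    mul_mem_matrix_wordSpan (by omega) hX hY
  have m₂ {X Y : Matrix m m A} (hX : X ∈ (wordSpan v σ 2).matrix)
      (hY : Y ∈ (wordSpan v σ 1).matrix) : X * Y ∈ (wordSpan v σ 2).matrix :=
    mul_mem_matrix_wordSpan (by omega) hX hY
  exact add_mem (sub_mem (sub_mem (sub_mem (sub_mem (add_mem (add_mem (add_mem (m₂ hb hρ')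
    (m₂ hb hρ)) (m₁ hρ' ha)) (m₂ ha hρ)) (m₁ hρ ha)) (m₁ hρ hb)) (m₂ ha hρ')) (m₁ hρ' hb))
    (sub_mem (m₀ hρ' hρ) (m₀ hρ hρ'))

theorem quadratic_mem_matrix_wordSpan {h : F} (hh : v h ≤ 1)
    (hρ : ρ ∈ (wordSpan v σ 1).matrix) (hρ' : ρ' ∈ (wordSpan v σ 1).matrix)
    (ha : a ∈ (wordSpan v σ 2).matrix) (hb : b ∈ (wordSpan v σ 2).matrix) :
    b * (ρ' * a) + b * (ρ' * ρ) + b * (a * ρ) + ρ' * (a * ρ) - ρ * (a * ρ') - ρ * (a * b)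
        - ρ * (ρ' * b) - a * (ρ' * b) + h • (b * (ρ' * (a * ρ)) - ρ * (a * (ρ' * b)))
      ∈ (wordSpan v σ 3).matrix := by
  have m₀ {X Y : Matrix m m A} (hX : X ∈ (wordSpan v σ 1).matrix)
      (hY : Y ∈ (wordSpan v σ 1).matrix) : X * Y ∈ (wordSpan v σ 1).matrix :=
    mul_mem_matrix_wordSpan (by omega) hX hY
  have m₁ {X Y : Matrix m m A} (hX : X ∈ (wordSpan v σ 1).matrix)
      (hY : Y ∈ (wordSpan v σ 2).matrix) : X * Y ∈ (wordSpan v σ 2).matrix :=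
    mul_mem_matrix_wordSpan (by omega) hX hY
  have m₂ {X Y : Matrix m m A} (hX : X ∈ (wordSpan v σ 2).matrix)
      (hY : Y ∈ (wordSpan v σ 1).matrix) : X * Y ∈ (wordSpan v σ 2).matrix :=
    mul_mem_matrix_wordSpan (by omega) hX hY
  have m₃ {X Y : Matrix m m A} (hX : X ∈ (wordSpan v σ 2).matrix)
      (hY : Y ∈ (wordSpan v σ 2).matrix) : X * Y ∈ (wordSpan v σ 3).matrix :=
    mul_mem_matrix_wordSpan (by omega) hX hY
  have m₄ {X Y : Matrix m m A} (hX : X ∈ (wordSpan v σ 1).matrix)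
      (hY : Y ∈ (wordSpan v σ 3).matrix) : X * Y ∈ (wordSpan v σ 3).matrix :=
    mul_mem_matrix_wordSpan (by omega) hX hY
  have h₂₃ {X : Matrix m m A} (hX : X ∈ (wordSpan v σ 2).matrix) :
      X ∈ (wordSpan v σ 3).matrix := fun i j => wordSpan_mono (by omega) (hX i j)
  have hd : b * (ρ' * (a * ρ)) - ρ * (a * (ρ' * b)) ∈ (wordSpan v σ 3).matrix :=
    sub_mem (m₃ hb (m₁ hρ' (m₂ ha hρ))) (m₄ hρ (m₃ ha (m₁ hρ' hb)))
  refine add_mem (sub_mem (sub_mem (sub_mem (sub_mem (add_mem (add_mem (add_mem ?_ ?_) ?_) ?_)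
    ?_) ?_) ?_) ?_) fun i j => smul_mem_of_le_one hh (hd i j)
  · exact m₃ hb (m₁ hρ' ha)
  · exact h₂₃ (m₂ hb (m₀ hρ' hρ))
  · exact m₃ hb (m₂ ha hρ)
  · exact h₂₃ (m₁ hρ' (m₂ ha hρ))
  · exact h₂₃ (m₁ hρ (m₂ ha hρ'))
  · exact m₄ hρ (m₃ ha hb)
  · exact h₂₃ (m₁ hρ (m₁ hρ' hb))
  · exact m₃ ha (m₁ hρ' hb)

end

theorem amp1_mem_matrix {S : Submodule v.valuationSubring A} {X : Matrix (Fin N) (Fin N) A}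
    (hX : X ∈ S.matrix) : amp1 X ∈ S.matrix := fun p r => by
  rw [amp1, Matrix.of_apply]
  split_ifs
  · exact hX _ _
  · exact zero_mem _

theorem amp2_mem_matrix {S : Submodule v.valuationSubring A} {X : Matrix (Fin N) (Fin N) A}
    (hX : X ∈ S.matrix) : amp2 X ∈ S.matrix := fun p r => by
  rw [amp2, Matrix.of_apply]
  split_ifs
  · exact hX _ _
  · exact zero_mem _

end MatrixLattice

theorem amp1_one_add_smul (h : F) (X : Matrix (Fin N) (Fin N) A) :
    amp1 (1 + h • X) = 1 + h • amp1 X := by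
  ext p r
  by_cases h : p.2 = r.2 <;> simp [amp1, Matrix.one_apply, Prod.ext_iff, h]

theorem amp2_one_add_smul (h : F) (X : Matrix (Fin N) (Fin N) A) :
    amp2 (1 + h • X) = 1 + h • amp2 X := by
  ext p r
  by_cases h : p.1 = r.1 <;> simp [amp2, Matrix.one_apply, Prod.ext_iff, h]

theorem liftF_eq_one_add_smul {m : Type} [DecidableEq m] {h : F} (hh : h ≠ 0) (M : Matrix m m F) :
    (liftF F M : Matrix m m A) = 1 + h • liftF F (h⁻¹ • (M - 1)) := by
  ext i j
  by_cases hij : i = j <;> simp [liftF, hij, Algebra.smul_def, ← map_mul, hh]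

theorem lowerGen_commutator_mem (hq : v (q - 1) < 1) (hh : q - q⁻¹ ≠ 0) (h₂ : v 2 = 1)
    (hs : ∀ i j, i ≤ j → s i j = if i = j then 1 else 0)
    (hS : reflLHS F q (Matrix.of s) = reflRHS F q (Matrix.of s)) (p r : LowerPos N) :
    lowerGen q s p * lowerGen q s r - lowerGen q s r * lowerGen q s p
      ∈ wordSpan v (lowerGen q s) 2 ⊔ smallSpan v (lowerGen q s) 3 := by
  have hvh : v (q - q⁻¹) < 1 := v_sub_inv_lt hq
  have hρ := liftF_mem_matrix_wordSpan (A := A) (σ := lowerGen q s) (n := 1)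
    (fun (p r : Fin N × Fin N) => v_Rc_sub_one_le hq hh h₂ p.1 p.2 r.1 r.2) one_pos
  have hρ' := liftF_mem_matrix_wordSpan (A := A) (σ := lowerGen q s) (n := 1)
    (fun (p r : Fin N × Fin N) => v_Rct_sub_one_le hq hh h₂ p.1 p.2 r.1 r.2) one_pos
  set τ : Matrix (Fin N) (Fin N) A := (q - q⁻¹)⁻¹ • (Matrix.of s - 1) with hτ
  have hτS : Matrix.of s = 1 + (q - q⁻¹) • τ := by
    rw [hτ, smul_inv_smul₀ hh, add_sub_cancel]
  have hτp (p : LowerPos N) : τ p.1.1 p.1.2 = lowerGen q s p := by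
    simp [hτ, lowerGen, p.2.ne']
  have hτW : τ ∈ (wordSpan v (lowerGen q s) 2).matrix := fun i j => by
    rcases le_or_gt i j with h | h
    · simp [hτ, hs i j h, Matrix.one_apply]
    · rw [hτp ⟨(i, j), h⟩]
      exact gen_mem _
  have hτ₁ := amp1_mem_matrix hτW
  have hτ₂ := amp2_mem_matrix hτW
  rw [reflLHS, reflRHS, hτS, amp1_one_add_smul, amp2_one_add_smul, liftF_eq_one_add_smul hh,
    liftF_eq_one_add_smul hh (Rct F q N)] at hS
  have key := Matrix.ext_iff.2 (commutator_eq_of_reflection hh hS) (p.1.1, r.1.1)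
    (p.1.2, r.1.2)
  generalize (liftF F ((q - q⁻¹)⁻¹ • (Rc F q N - 1)) : Matrix _ _ A) = ρ at *
  generalize (liftF F ((q - q⁻¹)⁻¹ • (Rct F q N - 1)) : Matrix _ _ A) = ρ' at *
  rw [Matrix.sub_apply, amp1_mul_amp2_apply, amp2_mul_amp1_apply, hτp, hτp] at key
  rw [key, Matrix.add_apply, Matrix.smul_apply]
  generalize amp1 τ = a at *
  generalize amp2 τ = b at *
  have hl := linear_mem_matrix_wordSpan hρ hρ' hτ₁ hτ₂
  have hq := quadratic_mem_matrix_wordSpan hvh.le hρ hρ' hτ₁ hτ₂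
  exact Submodule.add_mem_sup (hl _ _) (smul_mem_smallSpan hvh (hq _ _))

end Specialization

/-! ### Injectivity -/

section Injectivity

variable {F : Type} [Field F] {q : F} {Γ : Type} [LinearOrderedCommGroupWithZero Γ]
  {v : Valuation F Γ} {N : ℕ}

theorem adjoin_lowerGen_sOS (hh : q - q⁻¹ ≠ 0) :
    Algebra.adjoin F (Set.range (lowerGen q (sOS F q N))) = ⊤ := by
  have h : RingQuot.mkAlgHom F (OSRel F q N) = FreeAlgebra.lift F fun p => sOS F q N p.1 p.2 := by
    ext p
    simp [sOS]
  rw [eq_top_iff, ← (AlgHom.range_eq_top _).2 (RingQuot.mkAlgHom_surjective F (OSRel F q N)), h,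
    ← Algebra.adjoin_range_eq_range_freeAlgebra_lift, Algebra.adjoin_le_iff]
  rintro _ ⟨⟨i, j⟩, rfl⟩
  rcases le_or_gt i j with hij | hij
  · simp only [sOS_of_le hij, SetLike.mem_coe]
    split_ifs
    · exact one_mem _
    · exact zero_mem _
  · have := Subalgebra.smul_mem _ (Algebra.subset_adjoin (R := F)
      (Set.mem_range_self (f := lowerGen q (sOS F q N)) ⟨(i, j), hij⟩)) (q - q⁻¹)
    rwa [smul_lowerGen hh] at this

theorem osHom_injective (hq : v (q - 1) < 1) (hh : q - q⁻¹ ≠ 0)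
    (hn : ∀ n : ℕ, n ≠ 0 → v (n : F) = 1) : Function.Injective (osHom F q N) := by
  have h0 : q ≠ 0 := by
    rintro rfl
    simp at hh
  have hw (l : List (LowerPos N)) : osHom F q N (word (lowerGen q (sOS F q N)) l)
      = word (lowerGen q (sE F q N)) l := by
    rw [word, word, map_list_prod, List.map_map]
    congr 2
    ext p
    rw [Function.comp_apply, lowerGen, map_smul, osHom_sOS, lowerGen]
  have hspan := span_word_multiset_eq_top (v := v)
    (lowerGen_commutator_mem hq hh (by simpa using hn 2 two_ne_zero) (fun i j => sOS_of_le)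
      reflLHS_sOS) (adjoin_lowerGen_sOS (N := N) hh)
  have hε (p : LowerPos N) : counit F q N (lowerGen q (sE F q N) p) = 0 := by
    rw [lowerGen, map_smul, counit, IsRTT.lift_sE]
    simp [p.2.ne']
  have hΔ (p : LowerPos N) (a b : Fin N) := coprod_formula_sub_mem (q := q) (s := sE F q N)
    hq hh (fun i j => sE_of_le) p a b
  simp only [← coprod_sE h0, ← Matrix.smul_apply, ← map_smul] at hΔ
  have hli := linearIndependent_word_multiset hn hε hΔ
  rw [injective_iff_map_eq_zero]
  intro x hx
  obtain ⟨z, rfl⟩ := (Finsupp.mem_span_range_iff_exists_finsupp).1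
    (hspan.symm ▸ Submodule.mem_top : x ∈ _)
  rw [Finsupp.sum, map_sum] at hx
  simp only [map_smul, hw] at hx
  rw [linearIndependent_iff.1 hli z (by rwa [Finsupp.linearCombination_apply]), Finsupp.sum_zero_index]

end Injectivity

section Valuation

open Polynomial

/-- The height one prime of `ℂ[X]` generated by `X - 1`. -/
def primeXSubOne : IsDedekindDomain.HeightOneSpectrum ℂ[X] where
  asIdeal := Ideal.span {X - C 1}
  isPrime := (Ideal.span_singleton_prime (X_sub_C_ne_zero 1)).2 (prime_X_sub_C 1)
  ne_bot := by
    rw [Ne, Ideal.span_singleton_eq_bot]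
    exact X_sub_C_ne_zero 1

theorem valuation_qq_sub_one : primeXSubOne.valuation FF (qq - 1) < 1 := by
  have h : qq - 1 = algebraMap ℂ[X] FF (X - C 1) := by
    simp [qq]
  rw [h, IsDedekindDomain.HeightOneSpectrum.valuation_lt_one_iff_mem]
  exact Ideal.mem_span_singleton_self _

theorem valuation_natCast {n : ℕ} (hn : n ≠ 0) : primeXSubOne.valuation FF (n : FF) = 1 := by
  have h : (n : FF) = algebraMap ℂ[X] FF (C (n : ℂ)) := by
    simp
  rw [h]
  refine (IsDedekindDomain.HeightOneSpectrum.valuation_le_one _ _).antisymm (not_lt.1 fun hlt => ?_)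
  rw [IsDedekindDomain.HeightOneSpectrum.valuation_lt_one_iff_mem] at hlt
  exact primeXSubOne.isPrime.ne_top (Ideal.eq_top_of_isUnit_mem _ hlt
    (isUnit_C.2 (Nat.cast_ne_zero.2 hn).isUnit))

theorem qq_sub_inv_ne_zero : qq - qq⁻¹ ≠ 0 := by
  have h0 : qq ≠ 0 := RatFunc.X_ne_zero
  intro h
  rw [sub_eq_zero, ← mul_eq_one_iff_eq_inv₀ h0] at h
  have : (X * X : ℂ[X]) = 1 := by
    apply RatFunc.algebraMap_injective ℂ
    simpa [qq] using h
  simpa using congrArg (eval 0) this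

end Valuation

/-- The abstract algebra `𝒮` with generators `s_ij` and relations
`s_ij = 0` for `i < j`, `s_ii = 1`, and `R S₁ Rᵗ S₂ = S₂ Rᵗ S₁ R` is isomorphic to
`U^tw_q(o_N)`, via `s_ij ↦ Σ_a t_ia t̄_ja`. -/
theorem stmt1 (N : ℕ) :
    ∃ φ : AlgOS FF qq N ≃ₐ[FF] UtwO FF qq N,
      ∀ i j : Fin N, (φ (sOS FF qq N i j) : UqGl FF qq N) = sE FF qq N i j := by
  exact ⟨(AlgEquiv.ofInjective (osHom FF qq N) (osHom_injective valuation_qq_sub_one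
    qq_sub_inv_ne_zero fun _ => valuation_natCast)).trans (Subalgebra.equivOfEq _ _ osHom_range),
    fun i j => osHom_sOS i j⟩
end
end
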